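/- Let X be a compact metrizable space. Then X is an absolute neighborhood retract (ANR) if and only if I_f(X) is an absolute neighborhood retract. -/

import Mathlib

open Real Set Topology

/-- The Dirac measure `δ_x` on `X`, as a functional on `C(X, ℝ)`: `δ_x(φ) = φ(x)`. -/
def dirac (X : Type*) [TopologicalSpace X] (x : X) : C(X, ℝ) → ℝ := fun φ => φ x

/-- The max-plus combination `⊕_{i=1}^n λ_i ⊙ δ_{x_i}`, i.e. the functional
`φ ↦ max_{1 ≤ i ≤ n} (λ_i + φ(x_i))`. -/
noncomputable def maxPlus {X : Type*} [TopologicalSpace X] {n : ℕ}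
    (lam : Fin n → ℝ) (x : Fin n → X) : C(X, ℝ) → ℝ :=
  fun φ => ⨆ i, (lam i + φ (x i))

/-- `μ : C(X, ℝ) → ℝ` is an idempotent probability measure:
(1) `μ(c_λ) = λ` for constant functions; (2) `μ(λ + φ) = λ + μ(φ)`;
(3) `μ(max(φ, ψ)) = max(μ(φ), μ(ψ))`. -/
def IsIPM {X : Type*} [TopologicalSpace X] (μ : C(X, ℝ) → ℝ) : Prop :=
  (∀ c : ℝ, μ (ContinuousMap.const X c) = c) ∧
  (∀ (c : ℝ) (φ : C(X, ℝ)), μ (ContinuousMap.const X c + φ) = c + μ φ) ∧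
  (∀ φ ψ : C(X, ℝ), μ (φ ⊔ ψ) = max (μ φ) (μ ψ))

/-- Membership in `I_ω(X)`: idempotent probability measures with finite support, i.e.
`μ = ⊕_{i=1}^n λ_i ⊙ δ_{x_i}` with `x_i` pairwise distinct, `λ_i ≤ 0` and `max_i λ_i = 0`. -/
def IsFS {X : Type*} [TopologicalSpace X] (μ : C(X, ℝ) → ℝ) : Prop :=
  ∃ n : ℕ, 0 < n ∧ ∃ (x : Fin n → X) (lam : Fin n → ℝ),
    Function.Injective x ∧ (∀ i, lam i ≤ 0) ∧ (∃ i, lam i = 0) ∧ μ = maxPlus lam x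

/-- Membership in `I_f(X)`: `μ = ⊕_{i=1}^n λ_i ⊙ δ_{x_i}` with `x_i` pairwise distinct,
a unique index `i₀` with `λ_{i₀} = 0`, and `λ_i ≤ -ln(n+1)` for every `i ≠ i₀`. -/
def IsIf {X : Type*} [TopologicalSpace X] (μ : C(X, ℝ) → ℝ) : Prop :=
  ∃ n : ℕ, 0 < n ∧ ∃ (x : Fin n → X) (lam : Fin n → ℝ) (i0 : Fin n),
    Function.Injective x ∧ lam i0 = 0 ∧
    (∀ i, i ≠ i0 → lam i ≤ -Real.log (n + 1)) ∧ μ = maxPlus lam x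

universe u

/-- A compact metrizable space `A` is an absolute neighborhood retract (ANR) if whenever
`A` is homeomorphic to a closed subspace `A'` of a compact metrizable space `Z`, there
exist an open set `U ⊆ Z` with `A' ⊆ U` and a continuous retraction `U → A'`. -/
def IsCompactANR (A : Type u) [TopologicalSpace A] : Prop :=
  ∀ (Z : Type u) [TopologicalSpace Z] [CompactSpace Z]
    [TopologicalSpace.MetrizableSpace Z] (A' : Set Z),
    IsClosed A' → Nonempty (A ≃ₜ A') →
    ∃ U : Set Z, IsOpen U ∧ A' ⊆ U ∧
      ∃ ρ : C(U, Z), (∀ u : U, ρ u ∈ A') ∧ ∀ u : U, (u : Z) ∈ A' → ρ u = (u : Z)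


open Filter

abbrev IfT (X : Type*) [TopologicalSpace X] := {μ : C(X, ℝ) → ℝ // IsIf μ}

lemma isIf_of_set {X : Type*} [TopologicalSpace X] (S : Set (X × ℝ)) (p0 : X) (N : ℕ)
    (P : Finset X) (hP : P.card ≤ N) (hS : ∀ q ∈ S, 0 ≤ q.2 ∧ q.2 ≤ 1)
    (h0 : (p0, (1:ℝ)) ∈ S) (hSP : ∀ q ∈ S, 0 < q.2 → q.1 ∈ P)
    (hle : ∀ q ∈ S, q.1 ≠ p0 → q.2 ≤ 1 / ((N:ℝ) + 1)) (R : C(X, ℝ) → ℝ)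
    (hR : ∀ φ : C(X, ℝ), IsLUB ((fun q : X × ℝ => q.2 * Real.exp (φ q.1)) '' S)
      (Real.exp (R φ))) : IsIf R := by
  classical
  set P' := P.filter (fun p => ∃ a, 0 < a ∧ (p, a) ∈ S) with hP'
  have hp0 : p0 ∈ P' := by
    rw [hP', Finset.mem_filter]
    exact ⟨hSP _ h0 (by norm_num), 1, by norm_num, h0⟩
  set W : X → ℝ := fun p => sSup {a | (p, a) ∈ S} with hW
  have hbdd : ∀ p, BddAbove {a | (p, a) ∈ S} := fun p => ⟨1, fun a ha => (hS _ ha).2⟩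
  have hleW : ∀ p a, (p, a) ∈ S → a ≤ W p := fun p a ha => le_csSup (hbdd p) ha
  have hWpos : ∀ p ∈ P', 0 < W p := by
    intro p hp
    rw [hP', Finset.mem_filter] at hp
    obtain ⟨_, a, ha, haS⟩ := hp
    exact ha.trans_le (hleW _ _ haS)
  have hWne : ∀ p ∈ P', ({a | (p, a) ∈ S} : Set ℝ).Nonempty := by
    intro p hp
    rw [hP', Finset.mem_filter] at hp
    obtain ⟨_, a, ha, haS⟩ := hp
    exact ⟨a, haS⟩
  have hW0 : W p0 = 1 := le_antisymm (csSup_le ⟨1, h0⟩ fun a ha => (hS _ ha).2) (hleW _ _ h0)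
  have hcard : (P'.card : ℝ) ≤ N := by
    exact_mod_cast (Finset.card_filter_le _ _).trans hP
  let e := P'.equivFin
  refine ⟨P'.card, Finset.card_pos.2 ⟨p0, hp0⟩, fun i => (e.symm i : X),
    fun i => Real.log (W (e.symm i)), e ⟨p0, hp0⟩, ?_, ?_, ?_, ?_⟩
  · exact Subtype.val_injective.comp e.symm.injective
  · simp [hW0]
  · intro i hi
    have hne : ((e.symm i : P') : X) ≠ p0 := by
      intro h
      apply hi
      rw [← e.apply_symm_apply i]
      congr 1
      exact Subtype.ext h
    have h1 : W (e.symm i) ≤ 1 / ((N:ℝ) + 1) :=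
      csSup_le (hWne _ (e.symm i).2) fun a ha => hle _ ha hne
    have h2 : W (e.symm i) ≤ ((P'.card : ℝ) + 1)⁻¹ := by
      rw [← one_div]
      refine h1.trans ?_
      apply one_div_le_one_div_of_le <;> [positivity; linarith]
    rw [← Real.log_inv]
    exact Real.log_le_log (hWpos _ (e.symm i).2) h2
  · funext φ
    have hfin : BddAbove (Set.range fun i => Real.log (W (e.symm i)) + φ (e.symm i : X)) :=
      (Set.finite_range _).bddAbove
    have : Nonempty (Fin P'.card) := ⟨e ⟨p0, hp0⟩⟩
    apply le_antisymm
    · rw [← Real.exp_le_exp]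
      apply (hR φ).2
      rintro _ ⟨⟨p, a⟩, hq, rfl⟩
      dsimp only
      rcases (hS _ hq).1.eq_or_lt with h | h
      · dsimp only at h; rw [← h, zero_mul]; positivity
      · have hp : p ∈ P' := by
          rw [hP', Finset.mem_filter]; exact ⟨hSP _ hq h, a, h, hq⟩
        have := le_ciSup hfin (e ⟨p, hp⟩)
        simp only [Equiv.symm_apply_apply] at this
        refine le_trans ?_ (Real.exp_le_exp.2 this)
        rw [Real.exp_add, Real.exp_log (hWpos p hp)]
        gcongr
        exact hleW _ _ hq
    · apply ciSup_le
      intro i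
      have hWle : W (e.symm i) ≤ Real.exp (R φ - φ (e.symm i : X)) := by
        apply csSup_le (hWne _ (e.symm i).2)
        intro a ha
        have := (hR φ).1 ⟨_, ha, rfl⟩
        dsimp only at this
        rw [Real.exp_sub, le_div_iff₀ (Real.exp_pos _)]
        exact this
      have := Real.log_le_log (hWpos _ (e.symm i).2) hWle
      rw [Real.log_exp] at this
      linarith

structure IfRep {X : Type*} [TopologicalSpace X] (μ : IfT X) where
  n : ℕ
  x : Fin n → X
  w : Fin n → ℝ
  i0 : Fin n
  w0 : w i0 = 1
  wpos : ∀ i, 0 < w i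
  wle : ∀ i, i ≠ i0 → w i ≤ 1 / ((n:ℝ) + 1)
  le : ∀ (φ : C(X, ℝ)) i, w i * Real.exp (φ (x i)) ≤ Real.exp (μ.1 φ)
  ex : ∀ φ : C(X, ℝ), ∃ i, w i * Real.exp (φ (x i)) = Real.exp (μ.1 φ)

lemma exists_rep {X : Type*} [TopologicalSpace X] (μ : IfT X) : Nonempty (IfRep μ) := by
  obtain ⟨μ, n, hn, x, lam, i0, hinj, h0, hle, rfl⟩ := μ
  have : Nonempty (Fin n) := ⟨i0⟩
  refine ⟨⟨n, x, fun i => Real.exp (lam i), i0, by simp [h0], fun i => Real.exp_pos _, ?_, ?_, ?_⟩⟩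
  · intro i hi
    have := Real.exp_le_exp.2 (hle i hi)
    rwa [Real.exp_neg, Real.exp_log (by positivity), ← one_div] at this
  · intro φ i
    rw [← Real.exp_add, Real.exp_le_exp]
    exact le_ciSup (f := fun i => lam i + φ (x i)) (Set.finite_range _).bddAbove i
  · intro φ
    obtain ⟨i, hi⟩ := exists_eq_ciSup_of_finite (f := fun i => lam i + φ (x i))
    refine ⟨i, ?_⟩
    rw [← Real.exp_add]
    exact congrArg _ hi

noncomputable def ifRep {X : Type*} [TopologicalSpace X] (μ : IfT X) : IfRep μ :=
  Classical.choice (exists_rep μ)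

section basics
variable {X : Type*} [TopologicalSpace X]

lemma IfRep.wle1 {μ : IfT X} (ρ : IfRep μ) (i : Fin ρ.n) : ρ.w i ≤ 1 := by
  by_cases h : i = ρ.i0
  · rw [h, ρ.w0]
  · refine (ρ.wle i h).trans ?_
    rw [div_le_one (by positivity)]
    linarith [(Nat.cast_nonneg ρ.n : (0:ℝ) ≤ ρ.n)]

lemma mu_mono_add (μ : IfT X) (φ ψ : C(X, ℝ)) (c : ℝ) (h : ∀ x, φ x ≤ ψ x + c) :
    μ.1 φ ≤ μ.1 ψ + c := by
  obtain ⟨i, hi⟩ := (ifRep μ).ex φ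
  rw [← Real.exp_le_exp, ← hi, Real.exp_add]
  calc _ ≤ (ifRep μ).w i * Real.exp (ψ ((ifRep μ).x i) + c) := by
        have := (ifRep μ).wpos i
        gcongr
        exact h _
    _ = ((ifRep μ).w i * Real.exp (ψ ((ifRep μ).x i))) * Real.exp c := by rw [Real.exp_add]; ring
    _ ≤ _ := by
        gcongr
        exact (ifRep μ).le _ _

lemma mu_zero (μ : IfT X) : μ.1 0 = 0 := by
  apply le_antisymm
  · obtain ⟨i, hi⟩ := (ifRep μ).ex 0
    rw [← Real.exp_le_exp, ← hi]
    simpa using (ifRep μ).wle1 i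
  · have := (ifRep μ).le 0 (ifRep μ).i0
    rw [(ifRep μ).w0] at this
    simpa using this

lemma mu_lip [CompactSpace X] (μ : IfT X) : LipschitzWith 1 (fun φ : C(X, ℝ) => μ.1 φ) := by
  apply LipschitzWith.of_le_add
  intro φ ψ
  apply mu_mono_add
  intro x
  have := ContinuousMap.dist_apply_le_dist (f := φ) (g := ψ) x
  rw [Real.dist_eq] at this
  linarith [le_abs_self (φ x - ψ x)]

lemma mu_eval_cont [CompactSpace X] : Continuous fun z : IfT X × C(X, ℝ) => z.1.1 z.2 := by
  apply continuous_prod_of_continuous_lipschitzWith' _ 1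
  · intro μ; exact mu_lip μ
  · intro φ
    exact (continuous_apply φ).comp continuous_subtype_val

noncomputable def diracIf (x : X) : IfT X :=
  ⟨dirac X x, 1, one_pos, fun _ => x, fun _ => 0, 0, Function.injective_of_subsingleton _, rfl,
    fun i hi => (hi (Subsingleton.elim _ _)).elim, by
      funext φ; simp [dirac, maxPlus]⟩

lemma diracIf_cont : Continuous (diracIf : X → IfT X) := by
  refine Continuous.subtype_mk (continuous_pi fun φ => ?_) _
  exact φ.continuous

noncomputable def mainPt (μ : IfT X) : X := (ifRep μ).x (ifRep μ).i0

lemma mainPt_cont [NormalSpace X] [T1Space X] : Continuous (mainPt : IfT X → X) := by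
  rw [continuous_iff_continuousAt]
  intro μ0
  rw [ContinuousAt, tendsto_def]
  intro s hs
  obtain ⟨O, hOs, hO, hxO⟩ := mem_nhds_iff.1 hs
  obtain ⟨f, hf0, hf1, hf⟩ := exists_continuous_zero_one_of_isClosed
    (isClosed_singleton (x := mainPt μ0)) hO.isClosed_compl
    (by rw [Set.disjoint_singleton_left]; simpa using hxO)
  have hl2 : 0 < Real.log 2 := Real.log_pos (by norm_num)
  let ψ : C(X, ℝ) := Real.log 2 • f
  have hψ0 : ψ (mainPt μ0) = 0 := by
    simp [ψ, hf0 (Set.mem_singleton _)]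
  have key : μ0.1 ψ < Real.log 2 := by
    obtain ⟨i, hi⟩ := (ifRep μ0).ex ψ
    rw [← Real.exp_lt_exp, ← hi, Real.exp_log (by norm_num)]
    by_cases h : i = (ifRep μ0).i0
    · subst h
      change _ * Real.exp (ψ (mainPt μ0)) < 2
      rw [hψ0, (ifRep μ0).w0]; norm_num
    · have h1 := (ifRep μ0).wle i h
      have hn : (1:ℝ) ≤ (ifRep μ0).n := by
        exact_mod_cast Nat.one_le_iff_ne_zero.2 (fun h0 => by
          have := (ifRep μ0).i0.2; omega)
      have h2 : (ifRep μ0).w i ≤ 1 / 2 := h1.trans (one_div_le_one_div_of_le (by norm_num) (by linarith))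
      have h3 : Real.exp (ψ ((ifRep μ0).x i)) ≤ 2 := by
        rw [← Real.exp_log (show (0:ℝ) < 2 by norm_num), Real.exp_le_exp]
        simp only [ψ, ContinuousMap.coe_smul, Pi.smul_apply, smul_eq_mul]
        nlinarith [(hf ((ifRep μ0).x i)).2]
      have := (ifRep μ0).wpos i
      nlinarith [Real.exp_pos (ψ ((ifRep μ0).x i))]
  have hopen : IsOpen {μ : IfT X | μ.1 ψ < Real.log 2} :=
    isOpen_lt ((continuous_apply ψ).comp continuous_subtype_val) continuous_const
  filter_upwards [hopen.mem_nhds key] with μ hμ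
  apply hOs
  by_contra hcon
  have h1 : ψ (mainPt μ) = Real.log 2 := by
    simp [ψ, hf1 (show mainPt μ ∈ Oᶜ from hcon)]
  have h2 := (ifRep μ).le ψ (ifRep μ).i0
  rw [(ifRep μ).w0, one_mul, Real.exp_le_exp] at h2
  change ψ (mainPt μ) ≤ _ at h2
  rw [h1] at h2
  exact absurd hμ (not_lt.2 h2)

lemma mainPt_dirac [NormalSpace X] [T1Space X] (x : X) : mainPt (diracIf x) = x := by
  by_contra hne
  obtain ⟨f, hf0, hf1, hf⟩ := exists_continuous_zero_one_of_isClosed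
    (isClosed_singleton (x := x)) (isClosed_singleton (x := mainPt (diracIf x)))
    (by rw [Set.disjoint_singleton]; exact fun h => hne h.symm)
  have h2 := (ifRep (diracIf x)).le f (ifRep (diracIf x)).i0
  rw [(ifRep (diracIf x)).w0, one_mul, Real.exp_le_exp] at h2
  change f (mainPt (diracIf x)) ≤ f x at h2
  rw [hf0 (Set.mem_singleton _), hf1 (Set.mem_singleton _)] at h2
  norm_num at h2

end basics


set_option linter.unusedSectionVars false

section compactness
variable (X : Type*) [TopologicalSpace X]

abbrev PK := X × (ℕ → X) × (ℕ → Icc (0:ℝ) 1)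

def PKset : Set (PK X) :=
  {p | ∀ k l : ℕ, ((p.2.2 k : ℝ) ≤ 0) ∨ ((p.2.2 l : ℝ) ≤ 1 / ((k:ℝ) + 3))}

lemma PKset_closed : IsClosed (PKset X) := by
  have : PKset X = ⋂ k : ℕ, ⋂ l : ℕ, ({p : PK X | (p.2.2 k : ℝ) ≤ 0} ∪
      {p : PK X | (p.2.2 l : ℝ) ≤ 1 / ((k:ℝ) + 3)}) := by
    ext p; simp [PKset]
  rw [this]
  refine isClosed_iInter fun k => isClosed_iInter fun l => IsClosed.union ?_ ?_
  · exact isClosed_le (by fun_prop) continuous_const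
  · exact isClosed_le (by fun_prop) continuous_const

variable {X}

def Sset (p : PK X) : Set (X × ℝ) :=
  insert (p.1, 1) (Set.range fun k => (p.2.1 k, (p.2.2 k : ℝ)))

lemma Sset_unit (p : PK X) : ∀ q ∈ Sset p, 0 ≤ q.2 ∧ q.2 ≤ 1 := by
  rintro q (rfl | ⟨k, rfl⟩)
  · simp
  · exact (p.2.2 k).2

noncomputable def Gfun (φ : C(X, ℝ)) (p : PK X) : ℝ :=
  sSup ((fun q : X × ℝ => q.2 * Real.exp (φ q.1)) '' Sset p)

noncomputable def GN (φ : C(X, ℝ)) (p : PK X) : ℕ → ℝ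
  | 0 => Real.exp (φ p.1)
  | (k+1) => max (GN φ p k) ((p.2.2 k : ℝ) * Real.exp (φ (p.2.1 k)))

lemma GN_cont (φ : C(X, ℝ)) (k : ℕ) : Continuous fun p : PK X => GN φ p k := by
  induction k with
  | zero => simp only [GN]; fun_prop
  | succ k ih => simp only [GN]; fun_prop

variable [CompactSpace X]

lemma Gbdd (φ : C(X, ℝ)) (p : PK X) :
    BddAbove ((fun q : X × ℝ => q.2 * Real.exp (φ q.1)) '' Sset p) := by
  refine ⟨Real.exp ‖φ‖, ?_⟩
  rintro _ ⟨q, hq, rfl⟩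
  have h1 := Sset_unit p q hq
  have h2 : Real.exp (φ q.1) ≤ Real.exp ‖φ‖ :=
    Real.exp_le_exp.2 ((le_abs_self _).trans (φ.norm_coe_le_norm q.1))
  dsimp only
  nlinarith [Real.exp_pos (φ q.1)]

lemma Gne (φ : C(X, ℝ)) (p : PK X) :
    ((fun q : X × ℝ => q.2 * Real.exp (φ q.1)) '' Sset p).Nonempty :=
  ⟨_, _, Set.mem_insert _ _, rfl⟩

lemma G_lub (φ : C(X, ℝ)) (p : PK X) :
    IsLUB ((fun q : X × ℝ => q.2 * Real.exp (φ q.1)) '' Sset p) (Gfun φ p) :=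
  isLUB_csSup (Gne φ p) (Gbdd φ p)

lemma G_pos (φ : C(X, ℝ)) (p : PK X) : 0 < Gfun φ p := by
  refine lt_of_lt_of_le ?_ ((G_lub φ p).1 ⟨_, Set.mem_insert _ _, rfl⟩)
  simp only [one_mul]
  exact Real.exp_pos _

lemma GN_le (φ : C(X, ℝ)) (p : PK X) (k : ℕ) : GN φ p k ≤ Gfun φ p := by
  induction k with
  | zero =>
    refine le_of_eq_of_le ?_ ((G_lub φ p).1 ⟨_, Set.mem_insert _ _, rfl⟩)
    simp [GN]
  | succ k ih =>
    refine max_le ih ((G_lub φ p).1 ⟨_, Set.mem_insert_of_mem _ ⟨k, rfl⟩, rfl⟩)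

lemma le_GN0 (φ : C(X, ℝ)) (p : PK X) (N : ℕ) : Real.exp (φ p.1) ≤ GN φ p N := by
  induction N with
  | zero => exact le_rfl
  | succ N ih => exact ih.trans (le_max_left _ _)

lemma le_GN (φ : C(X, ℝ)) (p : PK X) (k N : ℕ) (h : k < N) :
    (p.2.2 k : ℝ) * Real.exp (φ (p.2.1 k)) ≤ GN φ p N := by
  induction N with
  | zero => omega
  | succ N ih =>
    rcases Nat.lt_succ_iff_lt_or_eq.1 h with h | rfl
    · exact (ih h).trans (le_max_left _ _)
    · exact le_max_right _ _

lemma G_le (φ : C(X, ℝ)) (p : PK X) (hp : p ∈ PKset X) (N : ℕ) :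
    Gfun φ p ≤ GN φ p N + Real.exp ‖φ‖ / (N + 1) := by
  apply (G_lub φ p).2
  rintro _ ⟨q, (rfl | ⟨k, rfl⟩), rfl⟩
  · simp only [one_mul]
    have : 0 ≤ Real.exp ‖φ‖ / ((N:ℝ) + 1) := by positivity
    linarith [le_GN0 φ p N]
  · dsimp only
    by_cases h : k < N
    · have : 0 ≤ Real.exp ‖φ‖ / ((N:ℝ) + 1) := by positivity
      linarith [le_GN φ p k N h]
    · push Not at h
      have h1 : (p.2.2 k : ℝ) ≤ 1 / ((N:ℝ) + 1) := by
        have hkN : (N:ℝ) ≤ k := by exact_mod_cast h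
        rcases hp k k with h | h
        · exact h.trans (by positivity)
        · exact h.trans (one_div_le_one_div_of_le (by positivity) (by linarith))
      have h2 : Real.exp (φ (p.2.1 k)) ≤ Real.exp ‖φ‖ :=
        Real.exp_le_exp.2 ((le_abs_self _).trans (φ.norm_coe_le_norm _))
      have h3 := le_GN0 φ p N
      have h4 : (p.2.2 k : ℝ) * Real.exp (φ (p.2.1 k)) ≤ 1 / ((N:ℝ) + 1) * Real.exp ‖φ‖ := by
        gcongr
      rw [one_div_mul_eq_div] at h4
      linarith [Real.exp_pos (φ p.1)]

lemma G_cont (φ : C(X, ℝ)) : Continuous fun p : PKset X => Gfun φ p.1 := by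
  have : TendstoUniformly (fun N (p : PKset X) => GN φ p.1 N) (fun p => Gfun φ p.1) atTop := by
    rw [Metric.tendstoUniformly_iff]
    intro ε hε
    have : Tendsto (fun N : ℕ => Real.exp ‖φ‖ / ((N:ℝ) + 1)) atTop (𝓝 0) :=
      tendsto_const_nhds.div_atTop (tendsto_natCast_atTop_atTop.atTop_add tendsto_const_nhds)
    filter_upwards [this.eventually (gt_mem_nhds hε)] with N hN p
    rw [Real.dist_eq, abs_of_nonneg (by linarith [GN_le φ p.1 N])]
    linarith [G_le φ p.1 p.2 N]
  exact this.continuous (Frequently.of_forall fun N => (GN_cont φ N).comp continuous_subtype_val)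

lemma PK_isIf (p : PK X) (hp : p ∈ PKset X) : IsIf (fun φ : C(X, ℝ) => Real.log (Gfun φ p)) := by
  classical
  have hR : ∀ φ : C(X, ℝ), IsLUB ((fun q : X × ℝ => q.2 * Real.exp (φ q.1)) '' Sset p)
      (Real.exp (Real.log (Gfun φ p))) := by
    intro φ; rw [Real.exp_log (G_pos φ p)]; exact G_lub φ p
  by_cases h : ∃ l, 0 < (p.2.2 l : ℝ)
  · obtain ⟨l, hl⟩ := h
    obtain ⟨M, hM⟩ := exists_nat_gt (1 / (p.2.2 l : ℝ))
    have hb : ∀ k, 0 < (p.2.2 k : ℝ) → k ≤ M := by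
      intro k hk
      have h1 := (hp k l).resolve_left (not_le.2 hk)
      rw [le_one_div hl (by positivity)] at h1
      have : (k:ℝ) < M := by linarith
      exact_mod_cast this.le
    set k := Nat.findGreatest (fun k => 0 < (p.2.2 k : ℝ)) M with hk
    have hk1 : 0 < (p.2.2 k : ℝ) := Nat.findGreatest_spec (P := fun k => 0 < (p.2.2 k : ℝ)) (hb l hl) hl
    have hk2 : ∀ j, 0 < (p.2.2 j : ℝ) → j ≤ k := fun j hj => Nat.le_findGreatest (hb j hj) hj
    refine isIf_of_set (Sset p) p.1 (k + 2) (insert p.1 ((Finset.range (k+1)).image p.2.1)) ?_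
      (Sset_unit p) (Set.mem_insert _ _) ?_ ?_ _ hR
    · refine (Finset.card_insert_le _ _).trans ?_
      have := Finset.card_image_le (s := Finset.range (k+1)) (f := p.2.1)
      rw [Finset.card_range] at this
      omega
    · rintro _ (rfl | ⟨j, rfl⟩) hq
      · simp
      · refine Finset.mem_insert_of_mem (Finset.mem_image_of_mem _ ?_)
        rw [Finset.mem_range]
        exact Nat.lt_succ_of_le (hk2 j hq)
    · rintro _ (rfl | ⟨j, rfl⟩) hq
      · exact absurd rfl hq
      · have := (hp k j).resolve_left (not_le.2 hk1)
        refine this.trans (le_of_eq ?_)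
        push_cast; ring
  · push Not at h
    refine isIf_of_set (Sset p) p.1 1 {p.1} (by simp)
      (Sset_unit p) (Set.mem_insert _ _) ?_ ?_ _ hR
    · rintro _ (rfl | ⟨j, rfl⟩) hq
      · simp
      · exact absurd hq (not_lt.2 (h j))
    · rintro _ (rfl | ⟨j, rfl⟩) hq
      · exact absurd rfl hq
      · exact (h j).trans (by positivity)

noncomputable def PKmap (p : PKset X) : IfT X := ⟨_, PK_isIf p.1 p.2⟩

lemma PKmap_cont : Continuous (PKmap : PKset X → IfT X) := by
  refine Continuous.subtype_mk (continuous_pi fun φ => ?_) _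
  exact (G_cont φ).log fun p => (G_pos φ p.1).ne'

lemma PKmap_surj : Function.Surjective (PKmap : PKset X → IfT X) := by
  intro μ
  obtain ⟨n, x, w, i0, w0, wpos, wle, le, ex⟩ := ifRep μ
  have wle1 : ∀ i, w i ≤ 1 := by
    intro i
    by_cases h : i = i0
    · rw [h, w0]
    · refine (wle i h).trans ?_
      rw [div_le_one (by positivity)]
      linarith [(Nat.cast_nonneg n : (0:ℝ) ≤ n)]
  obtain ⟨m, rfl⟩ : ∃ m, n = m + 1 := ⟨n - 1, by have := i0.2; omega⟩
  let p : PK X := (x i0, fun k => if h : k < m then x (i0.succAbove ⟨k, h⟩) else x i0,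
    fun k => if h : k < m then ⟨w (i0.succAbove ⟨k, h⟩), (wpos _).le, wle1 _⟩ else
      ⟨0, le_rfl, zero_le_one⟩)
  have hp : p ∈ PKset X := by
    intro k l
    by_cases hk : k < m
    · right
      simp only [p]
      split_ifs with hl
      · refine (wle _ (Fin.succAbove_ne _ _)).trans ?_
        apply one_div_le_one_div_of_le (by positivity)
        have : (k:ℝ) + 1 ≤ m := by exact_mod_cast hk
        push_cast; linarith
      · positivity
    · left; simp [p, hk]
  refine ⟨⟨p, hp⟩, Subtype.ext (funext fun φ => ?_)⟩
  change Real.log (Gfun φ p) = μ.1 φ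
  rw [← Real.log_exp (μ.1 φ)]
  congr 1
  apply (G_lub φ p).unique
  constructor
  · rintro _ ⟨q, (rfl | ⟨k, rfl⟩), rfl⟩
    · have := le φ i0
      rw [w0] at this
      exact this
    · by_cases hk : k < m
      · simpa [p, hk] using le φ (i0.succAbove ⟨k, hk⟩)
      · simp [p, hk, Real.exp_nonneg]
  · intro b hb
    obtain ⟨i, hi⟩ := ex φ
    rw [← hi]
    rcases eq_or_ne i i0 with rfl | hne
    · exact hb ⟨_, Set.mem_insert _ _, by simp [p, w0]⟩
    · obtain ⟨j, rfl⟩ := Fin.exists_succAbove_eq hne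
      exact hb ⟨_, Set.mem_insert_of_mem _ ⟨j, rfl⟩, by simp [p]⟩

instance IfT_compact : CompactSpace (IfT X) := by
  have : CompactSpace (PKset X) := isCompact_iff_compactSpace.1 (PKset_closed X).isCompact
  exact PKmap_surj.compactSpace PKmap_cont

end compactness

section anr

/-- an ANR, embedded in `ℕ → ℝ`, is a neighborhood retract there -/
lemma anr_retract (A : Type u) [TopologicalSpace A] [CompactSpace A] [Nonempty A]
    (hA : IsCompactANR A) (i : A → ℕ → ℝ) (hi : Continuous i) (hinj : Function.Injective i) :
    ∃ (U : Set (ℕ → ℝ)) (r : (ℕ → ℝ) → A), IsOpen U ∧ (∀ a, i a ∈ U) ∧ ContinuousOn r U ∧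
      ∀ a, r (i a) = a := by
  classical
  have hb : ∀ c, ∃ M : ℝ, 0 ≤ M ∧ ∀ a, |i a c| ≤ M := by
    intro c
    obtain ⟨M, hM⟩ := (isCompact_range ((continuous_apply c).comp hi)).isBounded.exists_norm_le
    refine ⟨max M 0, le_max_right _ _, fun a => (hM _ ⟨a, rfl⟩).trans (le_max_left _ _)⟩
  choose M hM0 hM using hb
  let Z := ULift.{u} ((c : ℕ) → Icc (-M c) (M c))
  have hab : ∀ a c, i a c ∈ Icc (-M c) (M c) := fun a c => abs_le.1 (hM c a)
  let j : A → Z := fun a => ⟨fun c => ⟨i a c, hab a c⟩⟩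
  have hj : Continuous j := by
    refine continuous_uliftUp.comp (continuous_pi fun c => ?_)
    exact Continuous.subtype_mk ((continuous_apply c).comp hi) _
  have hjinj : Function.Injective j := by
    intro a b hab
    apply hinj
    funext c
    have := congrArg (fun z : Z => ((z.down c : Icc _ _) : ℝ)) hab
    exact this
  have hemb : IsClosedEmbedding j := hj.isClosedEmbedding hjinj
  have : TopologicalSpace.MetrizableSpace Z := (Homeomorph.ulift.isEmbedding).metrizableSpace
  obtain ⟨U, hU, hAU, ρ, hρ1, hρ2⟩ := hA Z (Set.range j) hemb.isClosed_range
    ⟨hemb.isEmbedding.toHomeomorph⟩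
  let e := hemb.isEmbedding.toHomeomorph
  let p : (ℕ → ℝ) → Z := fun q => ⟨fun c => Set.projIcc (-M c) (M c) (by linarith [hM0 c]) (q c)⟩
  have hp : Continuous p := by
    refine continuous_uliftUp.comp (continuous_pi fun c => ?_)
    exact continuous_projIcc.comp (continuous_apply c)
  have hpi : ∀ a, p (i a) = j a := by
    intro a
    simp only [p, j]
    congr 1
    funext c
    exact Set.projIcc_of_mem _ (hab a c)
  let r : (ℕ → ℝ) → A := fun q => if h : p q ∈ U then e.symm ⟨ρ ⟨p q, h⟩, hρ1 _⟩ else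
    Classical.arbitrary A
  refine ⟨p ⁻¹' U, r, hU.preimage hp, ?_, ?_, ?_⟩
  · intro a
    change p (i a) ∈ U
    rw [hpi]; exact hAU ⟨a, rfl⟩
  · rw [continuousOn_iff_continuous_domRestrict]
    have : (p ⁻¹' U).domRestrict r = fun q : p ⁻¹' U => e.symm ⟨ρ ⟨p q, q.2⟩, hρ1 _⟩ := by
      funext q
      simp only [Set.domRestrict_apply, r]
      rw [dif_pos (show p q ∈ U from q.2)]
    rw [this]
    refine e.symm.continuous.comp (Continuous.subtype_mk (ρ.continuous.comp
      (Continuous.subtype_mk (hp.comp continuous_subtype_val) _)) _)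
  · intro a
    have h : p (i a) ∈ U := by rw [hpi]; exact hAU ⟨a, rfl⟩
    simp only [r]
    rw [dif_pos h, Homeomorph.symm_apply_eq]
    apply Subtype.ext
    change ρ ⟨p (i a), h⟩ = j a
    rw [hρ2 ⟨p (i a), h⟩ ⟨a, (hpi a).symm⟩]
    exact hpi a

lemma if_embed (X : Type*) [TopologicalSpace X] [CompactSpace X]
    [TopologicalSpace.MetrizableSpace X] :
    ∃ i : IfT X → ℕ → ℝ, Continuous i ∧ Function.Injective i := by
  have : SecondCountableTopology X := by
    let := TopologicalSpace.metrizableSpaceMetric X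
    infer_instance
  refine ⟨fun μ k => μ.1 (TopologicalSpace.denseSeq C(X, ℝ) k), ?_, ?_⟩
  · exact continuous_pi fun k => (continuous_apply _).comp continuous_subtype_val
  · intro μ ν h
    apply Subtype.ext
    have h2 : (fun φ : C(X, ℝ) => μ.1 φ) = fun φ => ν.1 φ :=
      Continuous.ext_on (TopologicalSpace.denseRange_denseSeq C(X, ℝ)) (mu_lip μ).continuous
        (mu_lip ν).continuous (by rintro _ ⟨k, rfl⟩; exact congrFun h k)
    exact h2

lemma anr_of_empty (A : Type u) [TopologicalSpace A] [IsEmpty A] : IsCompactANR A := by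
  intro Z _ _ _ A' _ ⟨h⟩
  have : A' = ∅ := by
    ext z; simp only [Set.mem_empty_iff_false, iff_false]
    intro hz; exact isEmptyElim (h.symm ⟨z, hz⟩)
  subst this
  refine ⟨∅, isOpen_empty, le_rfl, ⟨fun u => u.2.elim, ?_⟩, ?_, ?_⟩
  · rw [continuous_iff_continuousAt]; exact fun u => u.2.elim
  · exact fun u => u.2.elim
  · exact fun u => u.2.elim

lemma backward (X : Type u) [TopologicalSpace X] [CompactSpace X]
    [TopologicalSpace.MetrizableSpace X] (h : IsCompactANR (IfT X)) : IsCompactANR X := by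
  rcases isEmpty_or_nonempty X with hX | ⟨⟨x0⟩⟩
  · exact anr_of_empty X
  have : Nonempty (IfT X) := ⟨diracIf x0⟩
  obtain ⟨i, hi, hinj⟩ := if_embed X
  obtain ⟨U, r, hU, hiU, hr, hri⟩ := anr_retract (IfT X) h i hi hinj
  intro Z _ _ _ A' hA' ⟨e⟩
  let f : C(A', ℕ → ℝ) := ⟨fun a => i (diracIf (e.symm a)),
    hi.comp (diracIf_cont.comp e.symm.continuous)⟩
  obtain ⟨g, hg⟩ := ContinuousMap.exists_restrict_eq hA' f
  have hg' : ∀ a : A', g a = i (diracIf (e.symm a)) := fun a => congrArg (fun k => k a) hg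
  refine ⟨g ⁻¹' U, hU.preimage g.continuous, ?_, ⟨fun u => e (mainPt (r (g u))), ?_⟩, ?_, ?_⟩
  · intro a ha
    change g a ∈ U
    rw [hg' ⟨a, ha⟩]; exact hiU _
  · refine continuous_subtype_val.comp (e.continuous.comp (mainPt_cont.comp ?_))
    exact hr.comp_continuous (g.continuous.comp continuous_subtype_val) fun u => u.2
  · intro u; exact (e _).2
  · intro u hu
    change ((e (mainPt (r (g u))) : A') : Z) = u
    rw [hg' ⟨u, hu⟩, hri, mainPt_dirac, Homeomorph.apply_symm_apply]

end anr


section closeness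
variable {X : Type*} [MetricSpace X] [CompactSpace X]

noncomputable def hat (μ : IfT X) (ψ : X → ℝ) : ℝ := ⨆ i, (ifRep μ).w i * ψ ((ifRep μ).x i)

lemma le_hat (μ : IfT X) (ψ : X → ℝ) (i) : (ifRep μ).w i * ψ ((ifRep μ).x i) ≤ hat μ ψ :=
  le_ciSup (f := fun i => (ifRep μ).w i * ψ ((ifRep μ).x i)) (Set.finite_range _).bddAbove i

lemma hat_ex (μ : IfT X) (ψ : X → ℝ) : ∃ i, (ifRep μ).w i * ψ ((ifRep μ).x i) = hat μ ψ := by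
  have : Nonempty (Fin (ifRep μ).n) := ⟨(ifRep μ).i0⟩
  exact exists_eq_ciSup_of_finite (f := fun i => (ifRep μ).w i * ψ ((ifRep μ).x i))

lemma hat_exp (μ : IfT X) (φ : C(X, ℝ)) : hat μ (fun x => Real.exp (φ x)) = Real.exp (μ.1 φ) := by
  apply le_antisymm
  · obtain ⟨i, hi⟩ := hat_ex μ (fun x => Real.exp (φ x))
    rw [← hi]; exact (ifRep μ).le φ i
  · obtain ⟨i, hi⟩ := (ifRep μ).ex φ
    rw [← hi]; exact le_hat μ (fun x => Real.exp (φ x)) i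

lemma hat_add_le (μ : IfT X) (ψ : X → ℝ) (ε : ℝ) (hε : 0 ≤ ε) :
    hat μ (fun x => ψ x + ε) ≤ hat μ ψ + ε := by
  obtain ⟨i, hi⟩ := hat_ex μ (fun x => ψ x + ε)
  rw [← hi]
  have h1 := le_hat μ ψ i
  have h2 := (ifRep μ).wle1 i
  nlinarith

lemma hat_le_add (μ : IfT X) (ψ : X → ℝ) (ε : ℝ) (hε : 0 ≤ ε) :
    hat μ ψ ≤ hat μ (fun x => ψ x + ε) := by
  obtain ⟨i, hi⟩ := hat_ex μ ψ
  rw [← hi]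
  have h1 := le_hat μ (fun x => ψ x + ε) i
  have h2 := (ifRep μ).wpos i
  nlinarith

lemma hat_cont {P : Type*} [TopologicalSpace P] (ψ : P → X → ℝ)
    (hc : Continuous fun z : P × X => ψ z.1 z.2) (h0 : ∀ p x, 0 ≤ ψ p x) :
    Continuous fun z : IfT X × P => hat z.1 (ψ z.2) := by
  have : TendstoUniformly (fun (N : ℕ) (z : IfT X × P) =>
      hat z.1 (fun x => ψ z.2 x + 1 / ((N:ℝ) + 1))) (fun z => hat z.1 (ψ z.2)) atTop := by
    rw [Metric.tendstoUniformly_iff]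
    intro ε hε
    filter_upwards [(tendsto_one_div_add_atTop_nhds_zero_nat (𝕜 := ℝ)).eventually
      (gt_mem_nhds hε)] with N hN z
    have h0 : (0:ℝ) ≤ 1 / ((N:ℝ) + 1) := by positivity
    have h1 := hat_add_le z.1 (ψ z.2) _ h0
    have h2 := hat_le_add z.1 (ψ z.2) _ h0
    rw [Real.dist_eq, abs_sub_comm, abs_of_nonneg (by linarith)]
    linarith
  refine this.continuous (Frequently.of_forall fun N => ?_)
  have hpos : ∀ z : P × X, 0 < ψ z.1 z.2 + 1 / ((N:ℝ) + 1) := fun z => by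
    have := h0 z.1 z.2
    positivity
  let F : C(P × X, ℝ) := ⟨fun z => Real.log (ψ z.1 z.2 + 1 / ((N:ℝ) + 1)),
    (hc.add continuous_const).log fun z => (hpos z).ne'⟩
  have h3 : Continuous fun z : IfT X × P => Real.exp (z.1.1 (F.curry z.2)) := by
    refine Real.continuous_exp.comp (mu_eval_cont.comp
      (continuous_fst.prodMk (F.curry.continuous.comp continuous_snd)))
  convert h3 using 2 with z
  rw [← hat_exp]
  congr 1
  funext x
  exact (Real.exp_log (hpos (z.2, x))).symm

def Hy (X : Type*) [TopologicalSpace X] : Set (IfT X × X × ℝ) :=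
  {p | 0 ≤ p.2.2 ∧ ∀ φ : C(X, ℝ), p.2.2 * Real.exp (φ p.2.1) ≤ Real.exp (p.1.1 φ)}

lemma Hy_le_one {p : IfT X × X × ℝ} (hp : p ∈ Hy X) : p.2.2 ≤ 1 := by
  have := hp.2 0
  rw [mu_zero] at this
  simpa using this

lemma Hy_compact : IsCompact (Hy X) := by
  have hcl : IsClosed (Hy X) := by
    have : Hy X = {p | 0 ≤ p.2.2} ∩ ⋂ φ : C(X, ℝ),
        {p | p.2.2 * Real.exp (φ p.2.1) ≤ Real.exp (p.1.1 φ)} := by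
      ext p; simp [Hy]
    rw [this]
    refine (isClosed_le continuous_const (by fun_prop)).inter (isClosed_iInter fun φ => ?_)
    refine isClosed_le (by fun_prop) ?_
    exact Real.continuous_exp.comp ((continuous_apply φ).comp
      (continuous_subtype_val.comp continuous_fst))
  have hK : IsCompact ((univ : Set (IfT X)) ×ˢ ((univ : Set X) ×ˢ Icc (0:ℝ) 1)) :=
    isCompact_univ.prod (isCompact_univ.prod isCompact_Icc)
  refine hK.of_isClosed_subset hcl ?_
  intro p hp
  exact ⟨trivial, trivial, hp.1, Hy_le_one hp⟩

lemma rep_mem_Hy (μ : IfT X) (i) : (μ, (ifRep μ).x i, (ifRep μ).w i) ∈ Hy X :=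
  ⟨((ifRep μ).wpos i).le, fun φ => (ifRep μ).le φ i⟩

lemma Hy_le_hat {p : IfT X × X × ℝ} (hp : p ∈ Hy X) (ψ : X → ℝ) (hψ : Continuous ψ)
    (h0 : ∀ x, 0 ≤ ψ x) : p.2.2 * ψ p.2.1 ≤ hat p.1 ψ := by
  apply le_of_forall_pos_le_add
  intro ε hε
  have hpos : ∀ x, 0 < ψ x + ε := fun x => by have := h0 x; positivity
  let φ : C(X, ℝ) := ⟨fun x => Real.log (ψ x + ε), (hψ.add continuous_const).log fun x => (hpos x).ne'⟩
  have h1 := hp.2 φ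
  rw [← hat_exp] at h1
  have h2 : (fun x => Real.exp (φ x)) = fun x => ψ x + ε := by
    funext x; exact Real.exp_log (hpos x)
  rw [h2] at h1
  have h3 : Real.exp (φ p.2.1) = ψ p.2.1 + ε := Real.exp_log (hpos _)
  rw [h3] at h1
  have h4 := hat_add_le p.1 ψ ε hε.le
  nlinarith [hp.1]

noncomputable def psi (p : X × Icc (0:ℝ) 1) (y : X) : ℝ := max ((p.2 : ℝ) - dist p.1 y) 0

lemma psi_cont : Continuous fun z : (X × Icc (0:ℝ) 1) × X => psi z.1 z.2 := by
  unfold psi; fun_prop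

noncomputable def e0 (μ ν : IfT X) : ℝ :=
  sSup ((fun p : X × Icc (0:ℝ) 1 => |hat μ (psi p) - hat ν (psi p)|) '' univ)

lemma hat_psi_cont : Continuous fun z : IfT X × (X × Icc (0:ℝ) 1) => hat z.1 (psi z.2) :=
  hat_cont psi psi_cont fun _ _ => le_max_right _ _

lemma e0_cont : Continuous fun z : IfT X × IfT X => e0 z.1 z.2 := by
  unfold e0
  apply IsCompact.continuous_sSup isCompact_univ
    (f := fun (z : IfT X × IfT X) (p : X × Icc (0:ℝ) 1) => |hat z.1 (psi p) - hat z.2 (psi p)|)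
  have h1 : Continuous fun q : (IfT X × IfT X) × (X × Icc (0:ℝ) 1) => hat q.1.1 (psi q.2) :=
    hat_psi_cont.comp (by fun_prop : Continuous
      fun q : (IfT X × IfT X) × (X × Icc (0:ℝ) 1) => (q.1.1, q.2))
  have h2 : Continuous fun q : (IfT X × IfT X) × (X × Icc (0:ℝ) 1) => hat q.1.2 (psi q.2) :=
    hat_psi_cont.comp (by fun_prop : Continuous
      fun q : (IfT X × IfT X) × (X × Icc (0:ℝ) 1) => (q.1.2, q.2))
  exact (h1.sub h2).abs

lemma le_e0 (μ ν : IfT X) (p : X × Icc (0:ℝ) 1) : |hat μ (psi p) - hat ν (psi p)| ≤ e0 μ ν := by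
  apply le_csSup
  · apply (isCompact_univ.image _).bddAbove
    have h1 : Continuous fun q : X × Icc (0:ℝ) 1 => hat μ (psi q) :=
      hat_psi_cont.comp (by fun_prop : Continuous fun q : X × Icc (0:ℝ) 1 => (μ, q))
    have h2 : Continuous fun q : X × Icc (0:ℝ) 1 => hat ν (psi q) :=
      hat_psi_cont.comp (by fun_prop : Continuous fun q : X × Icc (0:ℝ) 1 => (ν, q))
    exact (h1.sub h2).abs
  · exact ⟨p, trivial, rfl⟩

lemma e0_self (μ : IfT X) : e0 μ μ = 0 := by
  unfold e0
  simp only [sub_self, abs_zero]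
  have : Nonempty (X × Icc (0:ℝ) 1) := ⟨(mainPt μ, ⟨0, by simp⟩)⟩
  rw [Set.image_univ, Set.range_const, csSup_singleton]

lemma closeness {p : IfT X × X × ℝ} (hp : p ∈ Hy X) (ν : IfT X) (s : ℝ) (hs : 0 < s)
    (hs1 : s ≤ 1) (he : e0 p.1 ν ≤ s ^ 2) (ha : s < p.2.2) :
    ∃ i, dist p.2.1 ((ifRep ν).x i) ≤ s ∧ p.2.2 - s ≤ (ifRep ν).w i := by
  let q : X × Icc (0:ℝ) 1 := (p.2.1, ⟨s, hs.le, hs1⟩)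
  have h1 := Hy_le_hat hp (psi q) (psi_cont.comp (by fun_prop : Continuous fun y : X => (q, y)))
    fun _ => le_max_right _ _
  have h2 : psi q p.2.1 = s := by simp [psi, q, hs.le]
  have h3 := (le_abs_self _).trans (le_e0 p.1 ν q)
  obtain ⟨i, hi⟩ := hat_ex ν (psi q)
  rw [h2] at h1
  have h4 : s * (p.2.2 - s) ≤ (ifRep ν).w i * psi q ((ifRep ν).x i) := by nlinarith
  have hw := (ifRep ν).wpos i
  have h5 : 0 < s * (p.2.2 - s) := mul_pos hs (by linarith)
  have h6 : 0 < psi q ((ifRep ν).x i) := by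
    by_contra hcon
    push Not at hcon
    nlinarith
  have h7 : psi q ((ifRep ν).x i) = s - dist p.2.1 ((ifRep ν).x i) := by
    unfold psi at h6 ⊢
    rcases lt_max_iff.1 h6 with h | h
    · rw [max_eq_left h.le]
    · exact absurd h (lt_irrefl _)
  rw [h7] at h4 h6
  refine ⟨i, by linarith, ?_⟩
  have := dist_nonneg (x := p.2.1) (y := (ifRep ν).x i)
  nlinarith

end closeness

section core
set_option linter.unusedSectionVars false
variable {X : Type*} [MetricSpace X] [CompactSpace X]

noncomputable def cl (x : ℝ) : ℝ := max 0 (min 1 x)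

lemma cl_nonneg (x : ℝ) : 0 ≤ cl x := le_max_left _ _
lemma cl_le_one (x : ℝ) : cl x ≤ 1 := by unfold cl; simp
lemma cl_one {x : ℝ} (h : 1 ≤ x) : cl x = 1 := by unfold cl; simp [h]
lemma cl_pos {x : ℝ} (h : 0 < cl x) : 0 < x := by
  unfold cl at h
  by_contra hx
  push Not at hx
  rw [max_eq_left ((min_le_right _ _).trans hx)] at h
  exact lt_irrefl _ h
@[fun_prop]
lemma cl_cont : Continuous cl := by unfold cl; fun_prop

noncomputable def Nker (k : IfT X → ℝ) (s : ℝ) (u : X → ℝ) (v : ℝ) (p : IfT X × X × ℝ) : ℝ :=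
  cl (4 * (k p.1 * p.2.2) / √s - 1) * cl (2 - |v - u p.2.1| / s)

noncomputable def Nn (k : IfT X → ℝ) (s : ℝ) (u : X → ℝ) (v : ℝ) : ℝ :=
  sSup ((Nker k s u v) '' Hy X)

noncomputable def TT (k : IfT X → ℝ) (s : ℝ) (u : X → ℝ) (x : ℝ) : ℝ :=
  ∫ v in (0:ℝ)..x, (1 - Nn k s u v)

noncomputable def bt (t α : ℝ) : ℝ := max (max (α - t) (2 * α - 1)) 0

lemma Nker_nonneg (k : IfT X → ℝ) (s : ℝ) (u : X → ℝ) (v : ℝ) (p) : 0 ≤ Nker k s u v p :=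
  mul_nonneg (cl_nonneg _) (cl_nonneg _)

lemma Nker_le (k : IfT X → ℝ) (s : ℝ) (u : X → ℝ) (v : ℝ) (p) : Nker k s u v p ≤ 1 :=
  mul_le_one₀ (cl_le_one _) (cl_nonneg _) (cl_le_one _)

lemma Nn_nonneg (k : IfT X → ℝ) (s : ℝ) (u : X → ℝ) (v : ℝ) : 0 ≤ Nn k s u v := by
  apply Real.sSup_nonneg
  rintro _ ⟨p, _, rfl⟩
  exact Nker_nonneg _ _ _ _ _

lemma Nn_le (k : IfT X → ℝ) (s : ℝ) (u : X → ℝ) (v : ℝ) : Nn k s u v ≤ 1 := by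
  apply Real.sSup_le _ zero_le_one
  rintro _ ⟨p, _, rfl⟩
  exact Nker_le _ _ _ _ _

lemma le_Nn (k : IfT X → ℝ) (s : ℝ) (u : X → ℝ) (v : ℝ) {p} (hp : p ∈ Hy X) :
    Nker k s u v p ≤ Nn k s u v := by
  apply le_csSup
  · refine ⟨1, ?_⟩
    rintro _ ⟨p, _, rfl⟩
    exact Nker_le _ _ _ _ _
  · exact ⟨p, hp, rfl⟩

lemma Nn_cont {W : Type*} [TopologicalSpace W] (k : W → IfT X → ℝ) (s : W → ℝ) (u : X → ℝ)
    (hk : Continuous fun z : W × IfT X => k z.1 z.2) (hs : Continuous s) (hs0 : ∀ w, 0 < s w)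
    (hu : Continuous u) : Continuous fun z : W × ℝ => Nn (k z.1) (s z.1) u z.2 := by
  unfold Nn
  apply IsCompact.continuous_sSup Hy_compact
    (f := fun (z : W × ℝ) (p : IfT X × X × ℝ) => Nker (k z.1) (s z.1) u z.2 p)
  have h1 : Continuous fun q : (W × ℝ) × (IfT X × X × ℝ) => k q.1.1 q.2.1 :=
    hk.comp (by fun_prop : Continuous fun q : (W × ℝ) × (IfT X × X × ℝ) => (q.1.1, q.2.1))
  have h2 : Continuous fun q : (W × ℝ) × (IfT X × X × ℝ) => s q.1.1 := hs.comp (by fun_prop)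
  have h3 : ∀ q : (W × ℝ) × (IfT X × X × ℝ), √(s q.1.1) ≠ 0 := fun q => (Real.sqrt_pos.2 (hs0 _)).ne'
  have h4 : ∀ q : (W × ℝ) × (IfT X × X × ℝ), (s q.1.1) ≠ 0 := fun q => (hs0 _).ne'
  change Continuous fun q : (W × ℝ) × (IfT X × X × ℝ) => 
    cl (4 * (k q.1.1 q.2.1 * q.2.2.2) / √(s q.1.1) - 1) * cl (2 - |q.1.2 - u q.2.2.1| / (s q.1.1))
  have h5 : Continuous fun q : (W × ℝ) × (IfT X × X × ℝ) => 
      4 * (k q.1.1 q.2.1 * q.2.2.2) / √(s q.1.1) := Continuous.div (by fun_prop) (by fun_prop) h3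
  have h6 : Continuous fun q : (W × ℝ) × (IfT X × X × ℝ) => 
      |q.1.2 - u q.2.2.1| / (s q.1.1) := Continuous.div (by fun_prop) (by fun_prop) h4
  fun_prop

lemma TT_cont {W : Type*} [TopologicalSpace W] (k : W → IfT X → ℝ) (s : W → ℝ) (u : X → ℝ)
    (hk : Continuous fun z : W × IfT X => k z.1 z.2) (hs : Continuous s) (hs0 : ∀ w, 0 < s w)
    (hu : Continuous u) : Continuous fun z : W × ℝ => TT (k z.1) (s z.1) u z.2 := by
  unfold TT
  have h := Nn_cont k s u hk hs hs0 hu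
  apply intervalIntegral.continuous_parametric_intervalIntegral_of_continuous
    (f := fun (z : W × ℝ) v => 1 - Nn (k z.1) (s z.1) u v) _ continuous_snd
  have h2 : Continuous fun q : (W × ℝ) × ℝ => Nn (k q.1.1) (s q.1.1) u q.2 :=
    h.comp (by fun_prop : Continuous fun q : (W × ℝ) × ℝ => (q.1.1, q.2))
  exact continuous_const.sub h2

/-- core data -/
structure Core (k : IfT X → ℝ) (s : ℝ) (ν : IfT X) : Prop where
  kc : Continuous k
  k0 : ∀ μ, 0 ≤ k μ
  k1 : ∀ μ, k μ ≤ 1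
  kν : k ν = 1
  s0 : 0 < s
  s1 : s < 1 / 100
  he : ∀ μ, 0 < k μ → e0 μ ν ≤ s ^ 2

variable {k : IfT X → ℝ} {s : ℝ} {ν : IfT X}

lemma Core.tpos (H : Core k s ν) : 0 < √s := Real.sqrt_pos.2 H.s0
lemma Core.tsq (H : Core k s ν) : √s * √s = s := Real.mul_self_sqrt H.s0.le
lemma Core.tlt (H : Core k s ν) : √s < 1 / 10 := by
  have := H.tsq; have := H.s1; have := H.tpos; nlinarith
lemma Core.slt (H : Core k s ν) : s < √s / 10 := by
  have := H.tsq; have := H.tlt; have := H.tpos; nlinarith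

lemma Core.mat (H : Core k s ν) {p} (hp : p ∈ Hy X) (hk : 0 < k p.1) (ha : s < p.2.2) :
    ∃ i, dist p.2.1 ((ifRep ν).x i) ≤ s ∧ p.2.2 - s ≤ (ifRep ν).w i :=
  closeness hp ν s H.s0 (by linarith [H.s1]) (H.he _ hk) ha

lemma Core.ka (H : Core k s ν) {p} (hp : p ∈ Hy X) : k p.1 * p.2.2 ≤ p.2.2 :=
  mul_le_of_le_one_left hp.1 (H.k1 _)

lemma Core.kpos (H : Core k s ν) {p} (hp : p ∈ Hy X) (h : 0 < k p.1 * p.2.2) : 0 < k p.1 := by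
  rcases (H.k0 p.1).eq_or_lt with h' | h'
  · rw [← h'] at h; simp at h
  · exact h'

lemma Core.N_one (H : Core k s ν) (u : X → ℝ) (v : ℝ) (j) (hj : √s / 2 ≤ (ifRep ν).w j)
    (hv : |v - u ((ifRep ν).x j)| ≤ s) : Nn k s u v = 1 := by
  apply le_antisymm (Nn_le _ _ _ _)
  refine le_of_eq_of_le ?_ (le_Nn k s u v (rep_mem_Hy ν j))
  have := H.tpos
  unfold Nker
  rw [cl_one, cl_one, one_mul]
  · have : |v - u ((ifRep ν).x j)| / s ≤ 1 := by rw [div_le_one H.s0]; exact hv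
    simp only; linarith
  · simp only [H.kν, one_mul]
    have : 2 ≤ 4 * (ifRep ν).w j / √s := by rw [le_div_iff₀ H.tpos]; linarith
    linarith

lemma Core.N_pos (H : Core k s ν) (u : X → ℝ) (hu : ∀ x y, |u x - u y| ≤ dist x y) (v : ℝ)
    (h : 0 < Nn k s u v) :
    ∃ j, √s / 8 ≤ (ifRep ν).w j ∧ |v - u ((ifRep ν).x j)| ≤ 3 * s := by
  have hne : (Nker k s u v '' Hy X).Nonempty := ⟨_, _, rep_mem_Hy ν (ifRep ν).i0, rfl⟩
  obtain ⟨_, ⟨p, hp, rfl⟩, hpp⟩ := exists_lt_of_lt_csSup hne h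
  unfold Nker at hpp
  have h1 := cl_pos (pos_of_mul_pos_left hpp (cl_nonneg _))
  have h2 := cl_pos (pos_of_mul_pos_right hpp (cl_nonneg _))
  have h3 : √s < 4 * (k p.1 * p.2.2) := by
    have : 1 < 4 * (k p.1 * p.2.2) / √s := by linarith
    rwa [one_lt_div H.tpos] at this
  have h4 : |v - u p.2.1| < 2 * s := by
    have : |v - u p.2.1| / s < 2 := by linarith
    rwa [div_lt_iff₀ H.s0] at this
  have h5 := H.ka hp
  have h6 := H.tpos
  have h7 := H.slt
  obtain ⟨j, hj, hw⟩ := H.mat hp (H.kpos hp (by linarith)) (by linarith)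
  refine ⟨j, by linarith, ?_⟩
  have h8 := hu p.2.1 ((ifRep ν).x j)
  have h9 := abs_sub_le v (u p.2.1) (u ((ifRep ν).x j))
  linarith

lemma Core.N_cont (H : Core k s ν) (u : X → ℝ) (hu : Continuous u) : Continuous (Nn k s u) := by
  have hkc := H.kc
  have h0 : Continuous fun z : Unit × IfT X => k z.2 := by fun_prop
  have h1 : Continuous fun _ : Unit => s := continuous_const
  have h := Nn_cont (W := Unit) (fun _ => k) (fun _ => s) u h0 h1 (fun _ => H.s0) hu
  have h2 : Continuous fun v : ℝ => (((), v) : Unit × ℝ) := by fun_prop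
  have h3 := h.comp h2
  simp only [Function.comp_def] at h3
  exact h3

lemma Core.T_eq (H : Core k s ν) (u : X → ℝ) (hu : ∀ x y, |u x - u y| ≤ dist x y) 
    (huc : Continuous u) (y : X) (j) (hj : √s / 2 ≤ (ifRep ν).w j)
    (hd : dist y ((ifRep ν).x j) ≤ s) : TT k s u (u y) = TT k s u (u ((ifRep ν).x j)) := by
  have hc : Continuous fun v => 1 - Nn k s u v := continuous_const.sub (H.N_cont u huc)
  rw [← sub_eq_zero]
  unfold TT
  rw [intervalIntegral.integral_interval_sub_left (hc.intervalIntegrable _ _) (hc.intervalIntegrable _ _)]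
  rw [intervalIntegral.integral_congr (g := fun _ => (0:ℝ))]
  · simp
  · intro v hv
    simp only
    rw [H.N_one u v j hj, sub_self]
    have h2 := hu y ((ifRep ν).x j)
    have h1 := Set.abs_sub_left_of_mem_uIcc hv
    linarith

lemma Core.cardJ (H : Core k s ν) :
    ((Finset.univ.filter fun j => √s / 8 ≤ (ifRep ν).w j).card : ℝ) * √s ≤ 8 := by
  have ht := H.tlt
  have ht0 := H.tpos
  by_cases h : ∃ j, j ≠ (ifRep ν).i0 ∧ √s / 8 ≤ (ifRep ν).w j
  · obtain ⟨j, hj, hw⟩ := h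
    have h1 := hw.trans ((ifRep ν).wle j hj)
    have h2 : ((Finset.univ.filter fun j => √s / 8 ≤ (ifRep ν).w j).card : ℝ) ≤ (ifRep ν).n := by
      have := Finset.card_filter_le (Finset.univ) (fun j => √s / 8 ≤ (ifRep ν).w j)
      rw [Finset.card_univ, Fintype.card_fin] at this
      exact_mod_cast this
    rw [le_div_iff₀ (by positivity)] at h1
    nlinarith
  · push Not at h
    have : (Finset.univ.filter fun j => √s / 8 ≤ (ifRep ν).w j).card ≤ 1 := by
      rw [Finset.card_le_one]
      intro a ha b hb
      simp only [Finset.mem_filter, Finset.mem_univ, true_and] at ha hb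
      have h1 : a = (ifRep ν).i0 := by
        by_contra hne; exact absurd ha (not_le.2 (h a hne))
      have h2 : b = (ifRep ν).i0 := by
        by_contra hne; exact absurd hb (not_le.2 (h b hne))
      rw [h1, h2]
    have : ((Finset.univ.filter fun j => √s / 8 ≤ (ifRep ν).w j).card : ℝ) ≤ 1 := by exact_mod_cast this
    nlinarith

lemma Core.disp (H : Core k s ν) (u : X → ℝ) (hu : ∀ x y, |u x - u y| ≤ dist x y) 
    (huc : Continuous u) (x : ℝ) : |TT k s u x - x| ≤ 48 * √s := by
  have hN := H.N_cont u huc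
  have h1 : TT k s u x - x = - ∫ v in (0:ℝ)..x, Nn k s u v := by
    unfold TT
    rw [intervalIntegral.integral_sub (by simp) (hN.intervalIntegrable _ _)]
    simp
  rw [h1, abs_neg]
  set J := Finset.univ.filter fun j => √s / 8 ≤ (ifRep ν).w j with hJ
  let E : Set ℝ := ⋃ j ∈ J, Metric.closedBall (u ((ifRep ν).x j)) (3 * s)
  have hE : MeasurableSet E := Finset.measurableSet_biUnion _ fun j _ => measurableSet_closedBall
  have hEv : MeasureTheory.volume E ≤ ENNReal.ofReal (J.card * (6 * s)) := by
    refine (MeasureTheory.measure_biUnion_finset_le _ _).trans ?_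
    simp only [Real.volume_closedBall]
    rw [Finset.sum_const, nsmul_eq_mul, ENNReal.ofReal_mul (p := (J.card : ℝ)) (by positivity), ENNReal.ofReal_natCast]
    refine mul_le_mul_right (ENNReal.ofReal_le_ofReal (by linarith)) _
  have hle : ∀ v, Nn k s u v ≤ E.indicator (fun _ => (1:ℝ)) v := by
    intro v
    by_cases hv : v ∈ E
    · rw [Set.indicator_of_mem hv]; exact Nn_le _ _ _ _
    · rw [Set.indicator_of_notMem hv]
      by_contra hc
      push Not at hc
      obtain ⟨j, hj, hj2⟩ := H.N_pos u hu v hc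
      apply hv
      simp only [E, Set.mem_iUnion]
      exact ⟨j, by simp [hJ, hj], by simpa [Metric.mem_closedBall, Real.dist_eq] using hj2⟩
  have hEf : MeasureTheory.volume E < ⊤ := hEv.trans_lt ENNReal.ofReal_lt_top
  have hint : MeasureTheory.Integrable (E.indicator (fun _ => (1:ℝ))) :=
    (MeasureTheory.integrable_indicator_iff hE).2 (by simp [hEf])
  calc |∫ v in (0:ℝ)..x, Nn k s u v| ≤ ∫ v in Set.uIoc 0 x, Nn k s u v := by
        have := intervalIntegral.norm_integral_le_integral_norm_uIoc (f := Nn k s u) (a := 0) (b := x)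
          (μ := MeasureTheory.volume)
        simpa [Real.norm_eq_abs, abs_of_nonneg (Nn_nonneg _ _ _ _)] using this
    _ ≤ ∫ v in Set.uIoc 0 x, E.indicator (fun _ => (1:ℝ)) v := by
        apply MeasureTheory.integral_mono _ hint.integrableOn hle
        exact (hN.intervalIntegrable 0 x).def'
    _ ≤ ∫ v, E.indicator (fun _ => (1:ℝ)) v := by
        apply MeasureTheory.setIntegral_le_integral hint
        exact Filter.Eventually.of_forall fun v => Set.indicator_nonneg (fun _ _ => zero_le_one) v
    _ = MeasureTheory.volume.real E := by
        rw [MeasureTheory.integral_indicator_const _ hE]; simp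
    _ ≤ J.card * (6 * s) := ENNReal.toReal_le_of_le_ofReal (by have := H.s0; positivity) hEv
    _ ≤ 48 * √s := by
        have := H.cardJ
        have h2 := H.tsq
        have h3 := H.tpos
        rw [← hJ] at this
        nlinarith
end core
section core2
set_option linter.unusedSectionVars false
variable {X : Type*} [MetricSpace X] [CompactSpace X]

noncomputable def TV (k : IfT X → ℝ) (s : ℝ) (ι : X → ℕ → ℝ) (y : X) : ℕ → ℝ :=
  fun c => TT k s (fun x => ι x c) (ι y c)

noncomputable def Gker (k : IfT X → ℝ) (s : ℝ) (ι : X → ℕ → ℝ) (Φ : C(ℕ → ℝ, ℝ))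
    (p : IfT X × X × ℝ) : ℝ :=
  bt (√s) (k p.1 * p.2.2) * Real.exp (Φ (TV k s ι p.2.1))

noncomputable def GG (k : IfT X → ℝ) (s : ℝ) (ι : X → ℕ → ℝ) (Φ : C(ℕ → ℝ, ℝ)) : ℝ :=
  sSup (Gker k s ι Φ '' Hy X)

lemma iota_cont {ι : X → ℕ → ℝ} (hι : ∀ c x y, |ι x c - ι y c| ≤ dist x y) (c : ℕ) :
    Continuous fun x => ι x c := by
  have : LipschitzWith 1 fun x => ι x c := by
    apply LipschitzWith.of_dist_le_mul
    intro x y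
    simpa [Real.dist_eq] using hι c x y
  exact this.continuous

lemma Gker_cont {W : Type*} [TopologicalSpace W] (k : W → IfT X → ℝ) (s : W → ℝ)
    (hk : Continuous fun z : W × IfT X => k z.1 z.2) (hs : Continuous s) (hs0 : ∀ w, 0 < s w)
    {ι : X → ℕ → ℝ} (hι : ∀ c x y, |ι x c - ι y c| ≤ dist x y) (Φ : C(ℕ → ℝ, ℝ)) :
    Continuous fun q : W × (IfT X × X × ℝ) => Gker (k q.1) (s q.1) ι Φ q.2 := by
  have h1 : Continuous fun q : W × (IfT X × X × ℝ) => k q.1 q.2.1 :=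
    hk.comp (by fun_prop : Continuous fun q : W × (IfT X × X × ℝ) => (q.1, q.2.1))
  have h2 : Continuous fun q : W × (IfT X × X × ℝ) => TV (k q.1) (s q.1) ι q.2.2.1 := by
    apply continuous_pi
    intro c
    have hc := iota_cont hι c
    have h3 := TT_cont k s (fun x => ι x c) hk hs hs0 hc
    have h4 : Continuous fun q : W × (IfT X × X × ℝ) => (q.1, ι q.2.2.1 c) := by fun_prop
    have h5 := h3.comp h4
    simp only [Function.comp_def] at h5
    unfold TV
    exact h5
  unfold Gker bt
  fun_prop

lemma GG_cont {W : Type*} [TopologicalSpace W] (k : W → IfT X → ℝ) (s : W → ℝ)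
    (hk : Continuous fun z : W × IfT X => k z.1 z.2) (hs : Continuous s) (hs0 : ∀ w, 0 < s w)
    {ι : X → ℕ → ℝ} (hι : ∀ c x y, |ι x c - ι y c| ≤ dist x y) (Φ : C(ℕ → ℝ, ℝ)) :
    Continuous fun w => GG (k w) (s w) ι Φ := by
  unfold GG
  apply IsCompact.continuous_sSup Hy_compact
    (f := fun (w : W) (p : IfT X × X × ℝ) => Gker (k w) (s w) ι Φ p)
  exact Gker_cont k s hk hs hs0 hι Φ

variable {k : IfT X → ℝ} {s : ℝ} {ν : IfT X} {ι : X → ℕ → ℝ}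

lemma Core.bdd (H : Core k s ν) (hι : ∀ c x y, |ι x c - ι y c| ≤ dist x y) (Φ : C(ℕ → ℝ, ℝ)) :
    BddAbove (Gker k s ι Φ '' Hy X) := by
  have hkc := H.kc
  have h0 : Continuous fun z : Unit × IfT X => k z.2 := by fun_prop
  have h1 : Continuous fun _ : Unit => s := continuous_const
  have h := Gker_cont (W := Unit) (fun _ => k) (fun _ => s) h0 h1 (fun _ => H.s0) hι Φ
  have h2 : Continuous fun v : IfT X × X × ℝ => (((), v) : Unit × (IfT X × X × ℝ)) := by fun_prop
  have h3 := h.comp h2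
  simp only [Function.comp_def] at h3
  exact (Hy_compact.image h3).bddAbove

lemma Core.lub (H : Core k s ν) (hι : ∀ c x y, |ι x c - ι y c| ≤ dist x y) (Φ : C(ℕ → ℝ, ℝ)) :
    IsLUB (Gker k s ι Φ '' Hy X) (GG k s ι Φ) :=
  isLUB_csSup ⟨_, _, rep_mem_Hy ν (ifRep ν).i0, rfl⟩ (H.bdd hι Φ)

lemma bt_nonneg (t α : ℝ) : 0 ≤ bt t α := le_max_right _ _
lemma bt_le {t α : ℝ} (ht : 0 < t) (h0 : 0 ≤ α) (h1 : α ≤ 1) : bt t α ≤ α := by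
  unfold bt
  refine max_le (max_le ?_ ?_) h0 <;> linarith
lemma le_bt (t α : ℝ) : α - t ≤ bt t α := le_max_of_le_left (le_max_left _ _)
lemma bt_one {t : ℝ} (ht : 0 < t) : bt t 1 = 1 := by
  apply le_antisymm (bt_le ht zero_le_one le_rfl)
  unfold bt
  exact le_max_of_le_left (le_max_of_le_right (by norm_num))
lemma bt_pos {t α : ℝ} (ht : t < 1 / 10) (h : 0 < bt t α) : t < α := by
  unfold bt at h
  rw [lt_max_iff, lt_max_iff] at h
  rcases h with (h | h) | h <;> linarith
lemma bt_le' {t α b : ℝ} (hb : 0 ≤ b) (h : α - t ≤ b) (h1 : α ≤ 1 / 2) : bt t α ≤ b := by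
  unfold bt
  refine max_le (max_le h ?_) hb; linarith

lemma Core.kap0 (H : Core k s ν) {p} (hp : p ∈ Hy X) : 0 ≤ k p.1 * p.2.2 :=
  mul_nonneg (H.k0 _) hp.1
lemma Core.kap1 (H : Core k s ν) {p} (hp : p ∈ Hy X) : k p.1 * p.2.2 ≤ 1 :=
  (H.ka hp).trans (Hy_le_one hp)

lemma Core.posG (H : Core k s ν) (hι : ∀ c x y, |ι x c - ι y c| ≤ dist x y) (Φ : C(ℕ → ℝ, ℝ)) :
    0 < GG k s ι Φ := by
  refine lt_of_lt_of_le ?_ ((H.lub hι Φ).1 ⟨_, rep_mem_Hy ν (ifRep ν).i0, rfl⟩)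
  unfold Gker
  simp only [H.kν, (ifRep ν).w0, one_mul, bt_one H.tpos]
  exact Real.exp_pos _

lemma Core.tv_disp (H : Core k s ν) (hι : ∀ c x y, |ι x c - ι y c| ≤ dist x y) (y : X) (c : ℕ) :
    |TV k s ι y c - ι y c| ≤ 48 * √s :=
  H.disp (fun x => ι x c) (hι c) (iota_cont hι c) (ι y c)

/-- matching for the retraction -/
lemma Core.mat2 (H : Core k s ν) (hι : ∀ c x y, |ι x c - ι y c| ≤ dist x y) {p} (hp : p ∈ Hy X)
    (hb : 0 < bt (√s) (k p.1 * p.2.2)) :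
    ∃ j, TV k s ι p.2.1 = TV k s ι ((ifRep ν).x j) ∧
      (j ≠ (ifRep ν).i0 → bt (√s) (k p.1 * p.2.2) ≤ 1 / (((ifRep ν).n : ℝ) + 1)) := by
  have h1 := bt_pos H.tlt hb
  have h2 := H.ka hp
  have h3 := H.slt
  have h4 := H.tpos
  have h5 := H.tlt
  obtain ⟨j, hj, hw⟩ := H.mat hp (H.kpos hp (by linarith)) (by linarith)
  refine ⟨j, ?_, ?_⟩
  · funext c
    exact H.T_eq (fun x => ι x c) (hι c) (iota_cont hι c) p.2.1 j (by linarith) hj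
  · intro hne
    have h6 := (ifRep ν).wle j hne
    have h7 : (2:ℝ) ≤ (ifRep ν).n := by
      have : 1 < (ifRep ν).n := by
        by_contra hlt
        have hl : (ifRep ν).n ≤ 1 := by omega
        apply hne
        apply Fin.ext
        have := j.2
        have := (ifRep ν).i0.2
        omega
      exact_mod_cast this
    have h8 : 1 / (((ifRep ν).n : ℝ) + 1) ≤ 1 / 3 := by
      apply one_div_le_one_div_of_le <;> linarith
    apply bt_le' (by positivity) <;> linarith

lemma Core.isIf (H : Core k s ν) (hι : ∀ c x y, |ι x c - ι y c| ≤ dist x y)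
    (r : (ℕ → ℝ) → X) (Φ : C(X, ℝ) → C(ℕ → ℝ, ℝ))
    (hΦ : ∀ φ y, Φ φ (TV k s ι y) = φ (r (TV k s ι y))) :
    IsIf fun φ => Real.log (GG k s ι (Φ φ)) := by
  classical
  refine isIf_of_set ((fun p : IfT X × X × ℝ => (r (TV k s ι p.2.1), bt (√s) (k p.1 * p.2.2))) '' Hy X)
    (r (TV k s ι ((ifRep ν).x (ifRep ν).i0))) (ifRep ν).n
    (Finset.univ.image fun j => r (TV k s ι ((ifRep ν).x j))) ?_ ?_ ?_ ?_ ?_ _ ?_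
  · exact Finset.card_image_le.trans (by simp)
  · rintro _ ⟨p, hp, rfl⟩
    exact ⟨bt_nonneg _ _, (bt_le H.tpos (H.kap0 hp) (H.kap1 hp)).trans (H.kap1 hp)⟩
  · refine ⟨_, rep_mem_Hy ν (ifRep ν).i0, ?_⟩
    simp only [H.kν, (ifRep ν).w0, one_mul, bt_one H.tpos]
  · rintro _ ⟨p, hp, rfl⟩ hb
    obtain ⟨j, hj, _⟩ := H.mat2 hι hp hb
    simp only [hj]
    exact Finset.mem_image_of_mem (fun j => r (TV k s ι ((ifRep ν).x j))) (Finset.mem_univ j)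
  · rintro _ ⟨p, hp, rfl⟩ hne
    simp only at hne ⊢
    rcases (bt_nonneg (√s) (k p.1 * p.2.2)).eq_or_lt with hb | hb
    · rw [← hb]; positivity
    · obtain ⟨j, hj, hj2⟩ := H.mat2 hι hp hb
      apply hj2
      rintro rfl
      exact hne (by rw [hj])
  · intro φ
    rw [Real.exp_log (H.posG hι _), Set.image_image]
    have := H.lub hι (Φ φ)
    unfold Gker at this
    simp only [hΦ] at this
    exact this

lemma Core.upper (H : Core k s ν) (hι : ∀ c x y, |ι x c - ι y c| ≤ dist x y) (Φ : C(ℕ → ℝ, ℝ))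
    (φ : C(X, ℝ)) (ε : ℝ) (hε : 0 ≤ ε)
    (hΦ : ∀ y, |Real.exp (Φ (TV k s ι y)) - Real.exp (φ y)| ≤ ε) (M : ℝ) (hM0 : 0 ≤ M)
    (hM : ∀ μ, 0 < k μ → Real.exp (μ.1 φ) ≤ M) : GG k s ι Φ ≤ M + ε := by
  apply (H.lub hι Φ).2
  rintro _ ⟨p, hp, rfl⟩
  unfold Gker
  rcases (bt_nonneg (√s) (k p.1 * p.2.2)).eq_or_lt with hb | hb
  · rw [← hb]; simp; positivity
  · have h1 := bt_pos H.tlt hb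
    have h2 := H.tpos
    have h3 := hM p.1 (H.kpos hp (by linarith))
    have h4 := hp.2 φ
    have h5 := (abs_le.1 (hΦ p.2.1)).2
    have h6 := (bt_le H.tpos (H.kap0 hp) (H.kap1 hp)).trans (H.ka hp)
    have h7 := Hy_le_one hp
    calc _ ≤ p.2.2 * (Real.exp (φ p.2.1) + ε) := by
          apply mul_le_mul h6 (by linarith) (Real.exp_pos _).le hp.1
      _ ≤ _ := by nlinarith

lemma Core.lower (H : Core k s ν) (hι : ∀ c x y, |ι x c - ι y c| ≤ dist x y) (Φ : C(ℕ → ℝ, ℝ))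
    (φ : C(X, ℝ)) (ε : ℝ) (hε : 0 ≤ ε)
    (hΦ : ∀ y, |Real.exp (Φ (TV k s ι y)) - Real.exp (φ y)| ≤ ε) :
    Real.exp (ν.1 φ) - √s * Real.exp ‖φ‖ - ε ≤ GG k s ι Φ := by
  obtain ⟨j, hj⟩ := (ifRep ν).ex φ
  have hp := rep_mem_Hy ν j
  refine le_trans ?_ ((H.lub hι Φ).1 ⟨_, hp, rfl⟩)
  unfold Gker
  have h0 := bt_nonneg (√s) (k ν * (ifRep ν).w j)
  have h1 := le_bt (√s) (k ν * (ifRep ν).w j)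
  have h2 : bt (√s) (k ν * (ifRep ν).w j) ≤ 1 := (bt_le H.tpos (H.kap0 hp) (H.kap1 hp)).trans (H.kap1 hp)
  have h3 := (abs_le.1 (hΦ ((ifRep ν).x j))).1
  have h4 : Real.exp (φ ((ifRep ν).x j)) ≤ Real.exp ‖φ‖ :=
    Real.exp_le_exp.2 ((le_abs_self _).trans (φ.norm_coe_le_norm _))
  have h5 := H.tpos
  simp only [H.kν, one_mul] at h0 h1 h2 ⊢
  set b := bt (√s) ((ifRep ν).w j)
  have h6 := Real.exp_pos (φ ((ifRep ν).x j))
  calc _ ≤ (ifRep ν).w j * Real.exp (φ ((ifRep ν).x j)) - √s * Real.exp (φ ((ifRep ν).x j)) - ε := by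
        rw [hj]; have := mul_le_mul_of_nonneg_left h4 h5.le; linarith
    _ ≤ b * Real.exp (φ ((ifRep ν).x j)) - b * ε := by nlinarith
    _ = b * (Real.exp (φ ((ifRep ν).x j)) - ε) := by ring
    _ ≤ _ := mul_le_mul_of_nonneg_left (by linarith) h0
end core2
section zpart
set_option linter.unusedSectionVars false
variable {X : Type*} [MetricSpace X] [CompactSpace X]
variable {Z : Type*} [MetricSpace Z]

noncomputable def kap (h : IfT X → Z) (m : ℝ) (z : Z) (μ : IfT X) : ℝ :=
  cl (m - dist z (h μ) / Metric.infDist z (range h))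

noncomputable def szk (h : IfT X → Z) (z : Z) (q : IfT X × IfT X) : ℝ :=
  √(e0 q.1 q.2) * kap h 3 z q.1 * kap h 3 z q.2

noncomputable def sz (h : IfT X → Z) (z : Z) : ℝ :=
  Metric.infDist z (range h) + sSup (szk h z '' univ)

variable {h : IfT X → Z} (hc : Continuous h)
include hc

lemma tau_pos [Nonempty (IfT X)] {z : Z} (hz : z ∉ range h) : 0 < Metric.infDist z (range h) :=
  ((isCompact_range hc).isClosed.notMem_iff_infDist_pos (range_nonempty h)).1 hz

lemma kap_cont [Nonempty (IfT X)] (m : ℝ) :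
    Continuous fun q : {z : Z // z ∉ range h} × IfT X => kap h m q.1 q.2 := by
  unfold kap
  have h1 : Continuous fun q : {z : Z // z ∉ range h} × IfT X =>
      dist (q.1 : Z) (h q.2) / Metric.infDist (q.1 : Z) (range h) := by
    apply Continuous.div
    · fun_prop
    · exact (Metric.continuous_infDist_pt _).comp (by fun_prop)
    · intro q; exact (tau_pos hc q.1.2).ne'
  fun_prop

lemma sz_cont [Nonempty (IfT X)] : Continuous fun z : {z : Z // z ∉ range h} => sz h z := by
  unfold sz
  apply Continuous.add
  · exact (Metric.continuous_infDist_pt _).comp (by fun_prop)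
  apply IsCompact.continuous_sSup isCompact_univ
    (f := fun (z : {z : Z // z ∉ range h}) (q : IfT X × IfT X) => szk h z q)
  have hk := kap_cont hc 3
  have h1 : Continuous fun q : {z : Z // z ∉ range h} × (IfT X × IfT X) => kap h 3 q.1 q.2.1 :=
    hk.comp (by fun_prop : Continuous fun q : {z : Z // z ∉ range h} × (IfT X × IfT X) => (q.1, q.2.1))
  have h2 : Continuous fun q : {z : Z // z ∉ range h} × (IfT X × IfT X) => kap h 3 q.1 q.2.2 :=
    hk.comp (by fun_prop : Continuous fun q : {z : Z // z ∉ range h} × (IfT X × IfT X) => (q.1, q.2.2))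
  have h3 : Continuous fun q : {z : Z // z ∉ range h} × (IfT X × IfT X) => e0 q.2.1 q.2.2 :=
    e0_cont.comp (by fun_prop : Continuous fun q : {z : Z // z ∉ range h} × (IfT X × IfT X) => q.2)
  change Continuous fun q : {z : Z // z ∉ range h} × (IfT X × IfT X) =>
    √(e0 q.2.1 q.2.2) * kap h 3 q.1 q.2.1 * kap h 3 q.1 q.2.2
  fun_prop

lemma kap_slice [Nonempty (IfT X)] (m : ℝ) (z : Z) (hz : z ∉ range h) : Continuous (kap h m z) := by
  have h1 := (kap_cont hc m).comp (by fun_prop : Continuous fun μ : IfT X =>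
    ((⟨z, hz⟩, μ) : {z : Z // z ∉ range h} × IfT X))
  simpa only [Function.comp_def] using h1

lemma szk_nonneg (z : Z) (q) : 0 ≤ szk h z q := by
  unfold szk kap
  have h1 := cl_nonneg (3 - dist z (h q.1) / Metric.infDist z (range h))
  have h2 := cl_nonneg (3 - dist z (h q.2) / Metric.infDist z (range h))
  positivity

lemma le_sz [Nonempty (IfT X)] (z : Z) (hz : z ∉ range h) (q) : szk h z q ≤ sz h z := by
  have h1 : szk h z q ≤ sSup (szk h z '' univ) := by
    refine le_csSup ?_ (mem_image_of_mem _ (mem_univ q))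
    have hk := kap_slice hc 3 z hz
    have h3 : Continuous fun q : (IfT X × IfT X) => e0 q.1 q.2 := e0_cont
    refine (isCompact_univ.image ?_).bddAbove
    unfold szk
    fun_prop
  have h2 := tau_pos hc hz
  unfold sz; linarith

lemma sz_pos [Nonempty (IfT X)] (z : Z) (hz : z ∉ range h) : 0 < sz h z := by
  have h2 := tau_pos hc hz
  have : 0 ≤ sSup (szk h z '' univ) := by
    apply Real.sSup_nonneg
    rintro _ ⟨q, _, rfl⟩
    exact szk_nonneg hc z q
  unfold sz; linarith

lemma exists_core [Nonempty (IfT X)] (z : Z) (hz : z ∉ range h) (hs : sz h z < 1 / 100) :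
    ∃ ν, Core (kap h 2 z) (sz h z) ν := by
  have ht := tau_pos hc hz
  obtain ⟨_, ⟨ν, rfl⟩, hν⟩ := (isCompact_range hc).exists_infDist_eq_dist (range_nonempty h) z
  have hν2 : kap h 2 z ν = 1 := by
    unfold kap
    rw [← hν, div_self ht.ne']
    exact cl_one (by norm_num)
  have h3 : ∀ μ, 0 < kap h 2 z μ → kap h 3 z μ = 1 := by
    intro μ hμ
    have := cl_pos hμ
    exact cl_one (by linarith)
  refine ⟨ν, kap_slice hc 2 z hz, fun μ => cl_nonneg _, fun μ => cl_le_one _, hν2,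
    sz_pos hc z hz, hs, ?_⟩
  intro μ hμ
  have h1 := le_sz hc z hz (μ, ν)
  unfold szk at h1
  simp only [h3 μ hμ, h3 ν (by rw [hν2]; exact one_pos), mul_one] at h1
  exact (Real.sqrt_le_left (sz_pos hc z hz).le).1 h1

lemma near_kap [Nonempty (IfT X)] (hinj : Function.Injective h) (μ0 : IfT X) (V : Set (IfT X))
    (hV : V ∈ 𝓝 μ0) :
    ∃ δ > 0, (∀ μ, dist (h μ) (h μ0) < δ → μ ∈ V) ∧
      ∀ z, z ∉ range h → dist z (h μ0) < δ → ∀ μ, 0 < kap h 3 z μ → μ ∈ V := by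
  have hemb := (hc.isClosedEmbedding hinj).isInducing
  rw [hemb.nhds_eq_comap, Filter.mem_comap] at hV
  obtain ⟨O, hO, hOV⟩ := hV
  obtain ⟨δ, hδ, hb⟩ := Metric.mem_nhds_iff.1 hO
  refine ⟨δ / 4, by positivity, ?_, ?_⟩
  · intro μ hμ
    exact hOV (hb (by rw [Metric.mem_ball]; linarith))
  · intro z hz hd μ hμ
    have ht := tau_pos hc hz
    have h1 := cl_pos hμ
    have h2 : dist z (h μ) < 3 * Metric.infDist z (range h) := by
      rw [← div_lt_iff₀ ht]; linarith
    have h3 : Metric.infDist z (range h) ≤ dist z (h μ0) :=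
      Metric.infDist_le_dist_of_mem (mem_range_self _)
    have h4 := dist_triangle_left (h μ) (h μ0) z
    exact hOV (hb (by rw [Metric.mem_ball]; linarith))

lemma near_sz [Nonempty (IfT X)] (hinj : Function.Injective h) (μ0 : IfT X) (ε : ℝ) (hε : 0 < ε) :
    ∃ δ > 0, ∀ z, z ∉ range h → dist z (h μ0) < δ → sz h z < ε := by
  have h1 : {q : IfT X × IfT X | e0 q.1 q.2 < (ε / 2) ^ 2} ∈ 𝓝 (μ0, μ0) := by
    apply (isOpen_lt e0_cont continuous_const).mem_nhds
    simp only [mem_ofPred_eq, e0_self]; positivity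
  rw [nhds_prod_eq, Filter.mem_prod_same_iff] at h1
  obtain ⟨V, hV, hVV⟩ := h1
  obtain ⟨δ, hδ, _, hd⟩ := near_kap hc hinj μ0 V hV
  refine ⟨min δ (ε / 2), by positivity, ?_⟩
  intro z hz hdz
  have h3 : Metric.infDist z (range h) ≤ dist z (h μ0) :=
    Metric.infDist_le_dist_of_mem (mem_range_self _)
  have h4 := hd z hz (hdz.trans_le (min_le_left _ _))
  have h5 : sSup (szk h z '' univ) ≤ ε / 2 := by
    apply Real.sSup_le _ (by positivity)
    rintro _ ⟨q, _, rfl⟩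
    unfold szk
    rcases (cl_nonneg (3 - dist z (h q.1) / Metric.infDist z (range h))).eq_or_lt with h6 | h6
    · unfold kap; rw [← h6]; simp; positivity
    rcases (cl_nonneg (3 - dist z (h q.2) / Metric.infDist z (range h))).eq_or_lt with h7 | h7
    · unfold kap; rw [← h7]; simp; positivity
    have h8 : e0 q.1 q.2 < (ε / 2) ^ 2 := hVV (mk_mem_prod (h4 q.1 h6) (h4 q.2 h7))
    have h9 : √(e0 q.1 q.2) ≤ ε / 2 := (Real.sqrt_le_left (by positivity)).2 h8.le
    have h10 : √(e0 q.1 q.2) * kap h 3 z q.1 ≤ ε / 2 :=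
      (mul_le_of_le_one_right (Real.sqrt_nonneg _) (cl_le_one _)).trans h9
    exact (mul_le_of_le_one_right (mul_nonneg (Real.sqrt_nonneg _) (cl_nonneg _)) (cl_le_one _)).trans h10
  have := hdz.trans_le (min_le_right _ _)
  unfold sz; linarith
end zpart

lemma tube {X : Type*} [MetricSpace X] [CompactSpace X] (ι : X → ℕ → ℝ) (hι : Continuous ι)
    (K : Set (X × (ℕ → ℝ))) (hK : IsOpen K) (h : ∀ y, (y, ι y) ∈ K) :
    ∃ δ > 0, ∀ y v, (∀ c, |v c - ι y c| ≤ δ) → (y, v) ∈ K := by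
  by_contra hne
  push Not at hne
  have : ∀ n : ℕ, ∃ y v, (∀ c, |v c - ι y c| ≤ 1 / ((n:ℝ) + 1)) ∧ (y, v) ∉ K :=
    fun n => hne _ (by positivity)
  choose y v h1 h2 using this
  obtain ⟨a, -, g, hg, hga⟩ := isCompact_univ.tendsto_subseq (x := y) (fun n => mem_univ _)
  have h3 : Tendsto (fun n => ι (y (g n))) atTop (𝓝 (ι a)) := (hι.tendsto a).comp hga
  have h4 : Tendsto (fun n => v (g n)) atTop (𝓝 (ι a)) := by
    rw [tendsto_pi_nhds] at h3 ⊢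
    intro c
    have h5 : Tendsto (fun n => v (g n) c - ι (y (g n)) c) atTop (𝓝 0) := by
      apply squeeze_zero_norm (a := fun n => 1 / (((g n : ℕ):ℝ) + 1))
      · intro n; exact h1 (g n) c
      · exact tendsto_one_div_add_atTop_nhds_zero_nat.comp hg.tendsto_atTop
    have := h5.add (h3 c)
    simpa using this
  have h6 := (hga.prodMk_nhds h4).eventually (hK.mem_nhds (h a))
  obtain ⟨n, hn⟩ := h6.exists
  exact h2 _ hn
section fwd
set_option linter.unusedSectionVars false

lemma fwd_iota (X : Type*) [MetricSpace X] [CompactSpace X] [Nonempty X] :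
    ∃ ι : X → ℕ → ℝ, Continuous ι ∧ Function.Injective ι ∧
      ∀ c x y, |ι x c - ι y c| ≤ dist x y := by
  refine ⟨fun y c => dist y (TopologicalSpace.denseSeq X c), by fun_prop, ?_, ?_⟩
  · intro x y hxy
    by_contra hne
    have hd : 0 < dist x y := dist_pos.2 hne
    obtain ⟨c, hc⟩ := Metric.denseRange_iff.1 (TopologicalSpace.denseRange_denseSeq X) x (dist x y / 2)
      (by positivity)
    have h1 := congrFun hxy c
    simp only at h1
    have h2 := dist_triangle_right x y (TopologicalSpace.denseSeq X c)
    linarith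
  · intro c x y
    exact abs_dist_sub_le x y _

lemma fwd_tietze {X : Type*} [TopologicalSpace X] (r : (ℕ → ℝ) → X) (C : Set (ℕ → ℝ))
    (hC : IsClosed C) (hr : ContinuousOn r C) (φ : C(X, ℝ)) :
    ∃ Φ : C(ℕ → ℝ, ℝ), ∀ v ∈ C, Φ v = φ (r v) := by
  let f : C(C, ℝ) := ⟨fun v => φ (r v), φ.continuous.comp (continuousOn_iff_continuous_domRestrict.1 hr)⟩
  obtain ⟨Φ, hΦ⟩ := ContinuousMap.exists_restrict_eq hC f
  refine ⟨Φ, fun v hv => ?_⟩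
  have := congrArg (fun g : C(C, ℝ) => g ⟨v, hv⟩) hΦ
  simpa [f] using this

variable {X : Type*} [MetricSpace X] [CompactSpace X] [Nonempty (IfT X)]
variable {Z : Type*} [MetricSpace Z] {h : IfT X → Z} {ι : X → ℕ → ℝ}

/-- continuity at points of the closed set -/
lemma fwd_cont_at (hc : Continuous h) (hinj : Function.Injective h) (hιc : Continuous ι)
    (hι : ∀ c x y, |ι x c - ι y c| ≤ dist x y) (φ : C(X, ℝ)) (Φ : C(ℕ → ℝ, ℝ))
    (hΦ : ∀ y, Φ (ι y) = φ y) (μ0 : IfT X) (ε : ℝ) (hε : 0 < ε) :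
    ∃ δ > 0, (∀ μ, dist (h μ) (h μ0) < δ → |Real.exp (μ.1 φ) - Real.exp (μ0.1 φ)| ≤ ε) ∧
      ∀ z, z ∉ range h → dist z (h μ0) < δ →
        |GG (kap h 2 z) (sz h z) ι Φ - Real.exp (μ0.1 φ)| ≤ 3 * ε := by
  obtain ⟨d1, hd1, ht⟩ := tube ι hιc {q | |Real.exp (Φ q.2) - Real.exp (φ q.1)| < ε}
    (isOpen_lt (by fun_prop) continuous_const) (by intro y; simp [hΦ, hε])
  have hev : Continuous fun μ : IfT X => Real.exp (μ.1 φ) :=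
    Real.continuous_exp.comp ((continuous_apply φ).comp continuous_subtype_val)
  obtain ⟨d2, hd2, hV1, hV2⟩ := near_kap hc hinj μ0 {μ | |Real.exp (μ.1 φ) - Real.exp (μ0.1 φ)| < ε}
    ((isOpen_lt (by fun_prop) continuous_const).mem_nhds (by simp [hε]))
  let t0 := min (1 / 10) (min (d1 / 48) (ε / Real.exp ‖φ‖))
  have ht0 : 0 < t0 := by positivity
  obtain ⟨d3, hd3, hs⟩ := near_sz hc hinj μ0 (t0 ^ 2) (by positivity)
  refine ⟨min d2 d3, by positivity, fun μ hμ => (hV1 μ (hμ.trans_le (min_le_left _ _))).le, ?_⟩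
  intro z hz hdz
  have hsz := hs z hz (hdz.trans_le (min_le_right _ _))
  have hV := hV2 z hz (hdz.trans_le (min_le_left _ _))
  have ht1 : t0 ≤ 1 / 10 := min_le_left _ _
  have ht2 : t0 ≤ d1 / 48 := (min_le_right _ _).trans (min_le_left _ _)
  have ht3 : t0 ≤ ε / Real.exp ‖φ‖ := (min_le_right _ _).trans (min_le_right _ _)
  obtain ⟨ν, H⟩ := exists_core hc z hz (by nlinarith)
  have hsq : √(sz h z) ≤ t0 := (Real.sqrt_le_left ht0.le).2 hsz.le
  have hb : ∀ y, |Real.exp (Φ (TV (kap h 2 z) (sz h z) ι y)) - Real.exp (φ y)| ≤ ε := by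
    intro y
    exact (ht y _ fun c => (H.tv_disp hι y c).trans (by linarith)).le
  have hk3 : ∀ μ, 0 < kap h 2 z μ → |Real.exp (μ.1 φ) - Real.exp (μ0.1 φ)| < ε := by
    intro μ hμ
    apply hV μ
    have := cl_pos hμ
    unfold kap
    rw [cl_one (by linarith)]; exact one_pos
  have hu := H.upper hι Φ φ ε hε.le hb (Real.exp (μ0.1 φ) + ε) (by positivity) (by
    intro μ hμ
    have := (abs_lt.1 (hk3 μ hμ)).2
    linarith)
  have hl := H.lower hι Φ φ ε hε.le hb
  have hν := (abs_lt.1 (hk3 ν (by rw [H.kν]; exact one_pos))).1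
  have h5 : √(sz h z) * Real.exp ‖φ‖ ≤ ε := by
    rw [← le_div_iff₀ (Real.exp_pos _)]; linarith
  rw [abs_le]; constructor <;> linarith

lemma fwd_cont_off (hc : Continuous h) (hι : ∀ c x y, |ι x c - ι y c| ≤ dist x y) (Φ : C(ℕ → ℝ, ℝ))
    (z : Z) (hz : z ∉ range h) : ContinuousAt (fun z => GG (kap h 2 z) (sz h z) ι Φ) z := by
  have h1 := GG_cont (W := {z : Z // z ∉ range h}) (fun w => kap h 2 w) (fun w => sz h w)
    (kap_cont hc 2) (sz_cont hc) (fun w => sz_pos hc w w.2) hι Φ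
  have hop : IsOpen {z : Z | z ∉ range h} := (isCompact_range hc).isClosed.isOpen_compl
  have h2 : ContinuousOn (fun z => GG (kap h 2 z) (sz h z) ι Φ) {z : Z | z ∉ range h} :=
    continuousOn_iff_continuous_domRestrict.2 h1
  exact h2.continuousAt (hop.mem_nhds hz)

lemma fwd_open (hc : Continuous h) (hinj : Function.Injective h) (s0 : ℝ) (hs0 : 0 < s0) :
    IsOpen {z : Z | z ∈ range h ∨ sz h z < s0} := by
  rw [isOpen_iff_mem_nhds]
  rintro z hz
  by_cases hzr : z ∈ range h
  · obtain ⟨μ0, rfl⟩ := hzr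
    obtain ⟨δ, hδ, hd⟩ := near_sz hc hinj μ0 s0 hs0
    filter_upwards [Metric.ball_mem_nhds _ hδ] with z hz
    by_cases h1 : z ∈ range h
    · exact Or.inl h1
    · exact Or.inr (hd z h1 hz)
  · have hlt : sz h z < s0 := hz.resolve_left hzr
    have hop : IsOpen {z : Z | z ∉ range h} := (isCompact_range hc).isClosed.isOpen_compl
    have h2 : ContinuousOn (fun z => sz h z) {z : Z | z ∉ range h} :=
      continuousOn_iff_continuous_domRestrict.2 (sz_cont hc)
    have h3 := (h2.continuousAt (hop.mem_nhds hzr)).eventually (gt_mem_nhds hlt)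
    filter_upwards [h3] with z hz
    exact Or.inr hz
end fwd

lemma forward_metric {X : Type*} [MetricSpace X] [CompactSpace X] [Nonempty (IfT X)] 
    {Z : Type*} [MetricSpace Z] {h : IfT X → Z} (hc : Continuous h) (hinj : Function.Injective h)
    (hX : ∀ ι : X → ℕ → ℝ, Continuous ι → Function.Injective ι → 
      ∃ (U : Set (ℕ → ℝ)) (r : (ℕ → ℝ) → X), IsOpen U ∧ (∀ a, ι a ∈ U) ∧ ContinuousOn r U ∧
        ∀ a, r (ι a) = a) :
    ∃ U : Set Z, IsOpen U ∧ range h ⊆ U ∧ ∃ F : U → IfT X, Continuous F ∧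
      ∀ (u : U) μ, (u : Z) = h μ → F u = μ := by
  classical
  have hXne : Nonempty X := ⟨mainPt (Classical.arbitrary (IfT X))⟩
  obtain ⟨ι, hιc, hιi, hι⟩ := fwd_iota X
  obtain ⟨U0, r, hU0, hιU0, hr, hrι⟩ := hX ι hιc hιi
  obtain ⟨u, huo, hu1, hu2⟩ := normal_exists_closure_subset (isCompact_range hιc).isClosed hU0
    (by rintro _ ⟨a, rfl⟩; exact hιU0 a)
  choose Φ hΦ using fwd_tietze r (closure u) isClosed_closure (hr.mono hu2)
  have hΦι : ∀ φ y, Φ φ (ι y) = φ y := by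
    intro φ y
    rw [hΦ φ _ (subset_closure (hu1 ⟨y, rfl⟩)), hrι]
  obtain ⟨d, hd, ht⟩ := tube ι hιc {q | q.2 ∈ u} (huo.preimage continuous_snd) (fun y => hu1 ⟨y, rfl⟩)
  let t0 := min (1 / 10) (d / 48)
  have ht0 : 0 < t0 := by positivity
  have ht1 : t0 ≤ 1 / 10 := min_le_left _ _
  have ht2 : t0 ≤ d / 48 := min_le_right _ _
  have hcore : ∀ z, z ∉ range h → sz h z < t0 ^ 2 → ∃ ν, Core (kap h 2 z) (sz h z) ν :=
    fun z hz hs => exists_core hc z hz (by nlinarith)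
  have hIf : ∀ z, z ∉ range h → sz h z < t0 ^ 2 →
      IsIf fun φ => Real.log (GG (kap h 2 z) (sz h z) ι (Φ φ)) := by
    intro z hz hs
    obtain ⟨ν, H⟩ := hcore z hz hs
    apply H.isIf hι r Φ
    intro φ y
    apply hΦ
    apply subset_closure
    have hsq : √(sz h z) ≤ t0 := (Real.sqrt_le_left ht0.le).2 hs.le
    exact ht y _ fun c => (H.tv_disp hι y c).trans (by linarith)
  let q : C(X, ℝ) → Z → ℝ := fun φ z => if hz : z ∈ range h then Real.exp (hz.choose.1 φ) else
    GG (kap h 2 z) (sz h z) ι (Φ φ)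
  have hq1 : ∀ φ μ, q φ (h μ) = Real.exp (μ.1 φ) := by
    intro φ μ
    have hz : h μ ∈ range h := ⟨μ, rfl⟩
    simp only [q, dif_pos hz]
    rw [hinj hz.choose_spec]
  have hq2 : ∀ φ z, z ∉ range h → q φ z = GG (kap h 2 z) (sz h z) ι (Φ φ) := by
    intro φ z hz
    simp only [q, dif_neg hz]
  let U : Set Z := {z : Z | z ∈ range h ∨ sz h z < t0 ^ 2}
  have hqc : ∀ φ, ∀ z ∈ U, ContinuousAt (q φ) z := by
    intro φ z hz
    by_cases hzr : z ∈ range h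
    · obtain ⟨μ0, rfl⟩ := hzr
      rw [Metric.continuousAt_iff]
      intro ε hε
      obtain ⟨δ, hδ, ha, hb⟩ := fwd_cont_at hc hinj hιc hι φ (Φ φ) (hΦι φ) μ0 (ε / 4) (by positivity)
      refine ⟨δ, hδ, ?_⟩
      intro z hz
      rw [hq1, Real.dist_eq]
      by_cases hzr : z ∈ range h
      · obtain ⟨μ, rfl⟩ := hzr
        rw [hq1]
        have := ha μ hz
        linarith
      · rw [hq2 _ _ hzr]
        have := hb z hzr hz
        linarith
    · have hop : IsOpen {z : Z | z ∉ range h} := (isCompact_range hc).isClosed.isOpen_compl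
      refine (fwd_cont_off hc hι (Φ φ) z hzr).congr ?_
      filter_upwards [hop.mem_nhds hzr] with z hz
      exact (hq2 φ z hz).symm
  have hqpos : ∀ φ, ∀ z ∈ U, 0 < q φ z := by
    intro φ z hz
    by_cases hzr : z ∈ range h
    · obtain ⟨μ0, rfl⟩ := hzr
      rw [hq1]; exact Real.exp_pos _
    · rw [hq2 _ _ hzr]
      obtain ⟨ν, H⟩ := hcore z hzr (hz.resolve_left hzr)
      exact H.posG hι _
  have hqIf : ∀ z ∈ U, IsIf fun φ => Real.log (q φ z) := by
    intro z hz
    by_cases hzr : z ∈ range h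
    · obtain ⟨μ0, rfl⟩ := hzr
      simp only [hq1, Real.log_exp]
      exact μ0.2
    · simp only [hq2 _ _ hzr]
      exact hIf z hzr (hz.resolve_left hzr)
  refine ⟨U, fwd_open hc hinj _ (by positivity), fun z hz => Or.inl hz,
    fun z => ⟨fun φ => Real.log (q φ z), hqIf z z.2⟩, ?_, ?_⟩
  · refine Continuous.subtype_mk (continuous_pi fun φ => ?_) _
    rw [continuous_iff_continuousAt]
    intro z
    have h1 : ContinuousAt (fun z => Real.log (q φ z)) (z : Z) :=
      (hqc φ z z.2).log (hqpos φ z z.2).ne'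
    exact ContinuousAt.comp (f := Subtype.val) (x := z) h1 continuous_subtype_val.continuousAt
  · rintro ⟨z, hz⟩ μ hu
    apply Subtype.ext
    simp only at hu
    subst hu
    funext φ
    simp only [hq1, Real.log_exp]

lemma forward (X : Type u) [TopologicalSpace X] [CompactSpace X]
    [TopologicalSpace.MetrizableSpace X] (hX : IsCompactANR X) : IsCompactANR (IfT X) := by
  letI := TopologicalSpace.metrizableSpaceMetric X
  by_cases hne : Nonempty (IfT X)
  · have hXne : Nonempty X := ⟨mainPt (Classical.arbitrary (IfT X))⟩
    intro Z _ _ _ A' hA' ⟨e⟩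
    letI := TopologicalSpace.metrizableSpaceMetric Z
    have hc : Continuous fun μ : IfT X => (e μ : Z) := by fun_prop
    have hinj : Function.Injective fun μ : IfT X => (e μ : Z) :=
      Subtype.val_injective.comp e.injective
    obtain ⟨U, hU, hsub, F, hF, hFe⟩ := forward_metric hc hinj (fun ι h1 h2 => anr_retract X hX ι h1 h2)
    refine ⟨U, hU, ?_, ⟨fun u => (e (F u) : Z), hc.comp hF⟩, fun u => (e (F u)).2, ?_⟩
    · intro z hz
      exact hsub ⟨e.symm ⟨z, hz⟩, by simp⟩
    · intro u hu
      have := hFe u (e.symm ⟨u, hu⟩) (by simp)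
      simp [this]
  · have : IsEmpty (IfT X) := not_nonempty_iff.1 hne
    exact anr_of_empty _

/-- a compact metrizable space `X` is an ANR if and only if `I_f(X)` is an
ANR. -/
theorem stmt17 (X : Type u) [TopologicalSpace X] [CompactSpace X]
    [TopologicalSpace.MetrizableSpace X] :
    IsCompactANR X ↔ IsCompactANR {μ : C(X, ℝ) → ℝ // IsIf μ} :=
  ⟨forward X, backward X⟩
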